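/- Let U and Y be complex Hilbert spaces and let f : D² → B(U,Y). Then f is analytic on D² with ‖f(z,ζ)‖ ≤ 1 for all (z,ζ) ∈ D² and symmetric (i.e., f(z,ζ) = f(ζ,z) for all (z,ζ) ∈ D²) if and only if there exist a complex Hilbert space H and bounded operators A₁, A₂ ∈ B(H), B ∈ B(U,H), C ∈ B(H,Y), D ∈ B(U,Y) such that the block operator M = [[A₁, A₂, B], [A₂, A₁, B], [C, C, D]] : H ⊕ H ⊕ U → H ⊕ H ⊕ Y is a contraction, and for every (z,ζ) ∈ D² the operator I − [[A₁,A₂],[A₂,A₁]]·diag(zI_H, ζI_H) on H ⊕ H is invertible and f(z,ζ) = D + [C C]·diag(zI_H, ζI_H)·(I − [[A₁,A₂],[A₂,A₁]]·diag(zI_H, ζI_H))⁻¹·[B; B]. -/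

import Mathlib

noncomputable section

open ContinuousLinearMap

/-- The open bidisk `𝔻² = {(z,ζ) : |z| < 1, |ζ| < 1}`. -/
def bidisk : Set (ℂ × ℂ) := {w : ℂ × ℂ | ‖w.1‖ < 1 ∧ ‖w.2‖ < 1}


/-- lurking isometry -/
theorem aux_lurk {J X X' : Type*} [NormedAddCommGroup X] [InnerProductSpace ℂ X] [CompleteSpace X]
    [NormedAddCommGroup X'] [InnerProductSpace ℂ X'] [CompleteSpace X']
    (a : J → X) (b : J → X') (h : ∀ i j, inner ℂ (a i) (a j) = inner ℂ (b i) (b j)) :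
    ∃ M : X →L[ℂ] X', (∀ x, ‖M x‖ ≤ ‖x‖) ∧ ∀ j, M (a j) = b j := by
  classical
  let ea : (J →₀ ℂ) →ₗ[ℂ] X := Finsupp.linearCombination ℂ a
  let eb : (J →₀ ℂ) →ₗ[ℂ] X' := Finsupp.linearCombination ℂ b
  have hin : ∀ c, inner ℂ (ea c) (ea c) = inner ℂ (eb c) (eb c) := by
    intro c
    simp only [ea, eb, Finsupp.linearCombination_apply, Finsupp.sum, sum_inner, inner_sum,
      inner_smul_left, inner_smul_right, h]
  have hn : ∀ c, ‖eb c‖ ≤ 1 * ‖ea c‖ := by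
    intro c
    have := hin c
    rw [inner_self_eq_norm_sq_to_K, inner_self_eq_norm_sq_to_K] at this
    have h2 : ‖ea c‖ ^ 2 = ‖eb c‖ ^ 2 := by exact_mod_cast this
    rw [one_mul]
    exact (pow_le_pow_iff_left₀ (norm_nonneg _) (norm_nonneg _) two_ne_zero).1 h2.ge
  let S : Submodule ℂ X := (LinearMap.range ea).topologicalClosure
  have : CompleteSpace S := (Submodule.isClosed_topologicalClosure _).completeSpace_coe
  let e' : (J →₀ ℂ) →ₗ[ℂ] S := LinearMap.codRestrict S ea
    (fun c => Submodule.le_topologicalClosure _ ⟨c, rfl⟩)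
  have hd : DenseRange e' := by
    intro x
    rw [Metric.mem_closure_iff]
    intro ε hε
    have hx : (x : X) ∈ closure (Set.range ea) := x.2
    obtain ⟨y, ⟨c, rfl⟩, hy⟩ := Metric.mem_closure_iff.1 hx ε hε
    exact ⟨e' c, ⟨c, rfl⟩, hy⟩
  have hn' : ∀ c, ‖eb c‖ ≤ 1 * ‖e' c‖ := hn
  refine ⟨(eb.extendOfNorm e') ∘L S.orthogonalProjectionOnto, ?_, ?_⟩
  · intro x
    have h1 := LinearMap.norm_extendOfNorm_apply_le (f := eb) (e := e') hd 1 hn'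
      (S.orthogonalProjectionOnto x)
    rw [one_mul] at h1
    exact h1.trans (Submodule.norm_orthogonalProjectionOnto_apply_le S x)
  · intro j
    have hj : e' (Finsupp.single j 1) = ⟨a j, Submodule.le_topologicalClosure _
        ⟨Finsupp.single j 1, by simp [ea]⟩⟩ := by
      apply Subtype.ext
      simp [e', ea]
    have h2 : S.orthogonalProjectionOnto (a j) = e' (Finsupp.single j 1) := by
      rw [hj]
      exact Submodule.orthogonalProjectionOnto_mem_subspace_eq_self (K := S) ⟨a j, _⟩
    rw [ContinuousLinearMap.comp_apply, h2, LinearMap.extendOfNorm_eq hd ⟨1, hn'⟩]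
    simp [eb]

theorem aux_sqrt {E : Type*} [NormedAddCommGroup E] [InnerProductSpace ℂ E] [CompleteSpace E]
    (S : E →L[ℂ] E) (hS : IsSelfAdjoint S) (h : ∀ x, 0 ≤ (inner ℂ x (S x) : ℂ).re) :
    ∃ D : E →L[ℂ] E, ∀ x y, inner ℂ (D x) (D y) = inner ℂ x (S y) := by
  have hpos : 0 ≤ S := by
    rw [ContinuousLinearMap.nonneg_iff_isPositive, ContinuousLinearMap.isPositive_def']
    refine ⟨hS, fun x => ?_⟩
    have := h x
    rw [ContinuousLinearMap.reApplyInnerSelf_apply, inner_re_symm]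
    exact this
  refine ⟨CFC.sqrt S, fun x y => ?_⟩
  have h1 : IsSelfAdjoint (CFC.sqrt S) := (CFC.sqrt_nonneg S).isSelfAdjoint
  have h2 := CFC.sqrt_mul_sqrt_self S hpos
  rw [← ContinuousLinearMap.adjoint_inner_right, h1.adjoint_eq]
  conv_rhs => rw [← h2]
  rfl


theorem aux_disk_coef {F : Type*} [NormedAddCommGroup F] [NormedSpace ℂ F] [CompleteSpace F]
    (g : ℂ → F) (hg : DifferentiableOn ℂ g (Metric.ball 0 1)) (hb : ∀ z, ‖z‖ < 1 → ‖g z‖ ≤ 1)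
    (n : ℕ) : ‖((n.factorial : ℂ)⁻¹) • iteratedDeriv n g 0‖ ≤ 1 := by
  have key : ∀ r : ℝ, 0 < r → r < 1 → ‖iteratedDeriv n g 0‖ * r ^ n ≤ n.factorial := by
    intro r h0 h1
    have h := Complex.norm_iteratedDeriv_le_of_forall_mem_sphere_norm_le (f := g) (c := 0) (R := r)
      (C := 1) n h0 ?_ ?_
    · rw [mul_one] at h
      rwa [← le_div_iff₀ (by positivity)]
    · apply DifferentiableOn.diffContOnCl
      apply hg.mono
      rw [closure_ball _ h0.ne']
      exact Metric.closedBall_subset_ball h1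
    · intro z hz
      apply hb
      simp at hz
      linarith
  have h2 : ‖iteratedDeriv n g 0‖ ≤ n.factorial := by
    have ht : Filter.Tendsto (fun r : ℝ => ‖iteratedDeriv n g 0‖ * r ^ n) (nhdsWithin 1 (Set.Iio 1))
        (nhds (‖iteratedDeriv n g 0‖ * 1 ^ n)) := by
      apply Filter.Tendsto.mono_left _ nhdsWithin_le_nhds
      apply Continuous.tendsto
      fun_prop
    rw [one_pow, mul_one] at ht
    refine le_of_tendsto ht ?_
    filter_upwards [Ioo_mem_nhdsLT (show (0:ℝ) < 1 by norm_num)] with r hr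
    exact key r hr.1 hr.2
  rw [norm_smul, norm_inv, Complex.norm_natCast, inv_mul_le_iff₀ (by positivity), mul_one]
  exact h2

theorem aux_bidisk_isOpen : IsOpen bidisk := by
  have : bidisk = (Metric.ball (0:ℂ) 1) ×ˢ (Metric.ball (0:ℂ) 1) := by
    ext w; simp [bidisk]
  rw [this]
  exact Metric.isOpen_ball.prod Metric.isOpen_ball

theorem aux_iter {F : Type*} [NormedAddCommGroup F] [NormedSpace ℂ F] [CompleteSpace F]
    (f : ℂ × ℂ → F) (hf : AnalyticOnNhd ℂ f bidisk) (n : ℕ) :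
    ∃ g : ℂ × ℂ → F, AnalyticOnNhd ℂ g bidisk ∧
      ∀ w ∈ bidisk, iteratedDeriv n (fun z => f (z, w.2)) w.1 = g w := by
  induction n with
  | zero => exact ⟨f, hf, by simp⟩
  | succ n ih =>
    obtain ⟨g, hg, hw⟩ := ih
    refine ⟨fun w => fderiv ℂ g w (1, 0), ?_, ?_⟩
    · intro w hw
      have := hg.fderiv w hw
      exact ((ContinuousLinearMap.apply ℂ F ((1:ℂ), (0:ℂ))).analyticAt _).comp this
    · rintro ⟨z, ζ⟩ hz
      rw [iteratedDeriv_succ]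
      have he : iteratedDeriv n (fun z => f (z, ζ)) =ᶠ[nhds z] fun z => g (z, ζ) := by
        filter_upwards [Metric.isOpen_ball.mem_nhds (show z ∈ Metric.ball (0:ℂ) 1 by simpa using hz.1)]
          with z' hz'
        exact hw (z', ζ) ⟨by simpa using hz', hz.2⟩
      rw [he.deriv_eq]
      have h1 : HasFDerivAt g (fderiv ℂ g (z, ζ)) (z, ζ) :=
        (hg (z, ζ) hz).differentiableAt.hasFDerivAt
      have h2 : HasDerivAt (fun z : ℂ => (z, ζ)) ((1:ℂ), (0:ℂ)) z :=
        (hasDerivAt_id z).prodMk (hasDerivAt_const z ζ)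
      exact (h1.comp_hasDerivAt z h2).deriv

theorem aux_coef {F : Type*} [NormedAddCommGroup F] [NormedSpace ℂ F] [CompleteSpace F]
    (f : ℂ × ℂ → F) (hf : AnalyticOnNhd ℂ f bidisk) (hb : ∀ w ∈ bidisk, ‖f w‖ ≤ 1) :
    ∃ a : ℕ × ℕ → F, (∀ k, ‖a k‖ ≤ 1) ∧
      ∀ w ∈ bidisk, HasSum (fun k : ℕ × ℕ => (w.1 ^ k.1 * w.2 ^ k.2) • a k) (f w) := by
  choose g hga hg using aux_iter f hf
  let α : ℕ → ℂ → F := fun j ζ => ((j.factorial : ℂ)⁻¹) • g j (0, ζ)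
  have hαd : ∀ j, DifferentiableOn ℂ (α j) (Metric.ball 0 1) := by
    intro j ζ hζ
    have h1 : DifferentiableAt ℂ (g j) (0, ζ) :=
      (hga j (0, ζ) ⟨by simp, by simpa using hζ⟩).differentiableAt
    have : DifferentiableAt ℂ (fun ζ : ℂ => g j (0, ζ)) ζ :=
      h1.comp ζ ((differentiableAt_const _).prodMk differentiableAt_id)
    exact (this.const_smul _).differentiableWithinAt
  have hslice : ∀ ζ : ℂ, ‖ζ‖ < 1 → DifferentiableOn ℂ (fun z => f (z, ζ)) (Metric.ball 0 1) := by
    intro ζ hζ z hz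
    have h1 : DifferentiableAt ℂ f (z, ζ) :=
      (hf (z, ζ) ⟨by simpa using hz, hζ⟩).differentiableAt
    exact (h1.comp z (differentiableAt_id.prodMk (differentiableAt_const _))).differentiableWithinAt
  have hgi : ∀ j ζ, ‖ζ‖ < 1 → iteratedDeriv j (fun z => f (z, ζ)) 0 = g j (0, ζ) := by
    intro j ζ hζ
    exact hg j (0, ζ) ⟨by simp, hζ⟩
  have hαb : ∀ j ζ, ‖ζ‖ < 1 → ‖α j ζ‖ ≤ 1 := by
    intro j ζ hζ
    have := aux_disk_coef (fun z => f (z, ζ)) (hslice ζ hζ) (fun z hz => hb _ ⟨hz, hζ⟩) j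
    rwa [hgi j ζ hζ] at this
  let a : ℕ × ℕ → F := fun k => ((k.2.factorial : ℂ)⁻¹) • iteratedDeriv k.2 (α k.1) 0
  have hab : ∀ k, ‖a k‖ ≤ 1 := fun k => aux_disk_coef (α k.1) (hαd k.1) (hαb k.1) k.2
  refine ⟨a, hab, ?_⟩
  rintro ⟨z, ζ⟩ ⟨hz, hζ⟩
  simp only at hz hζ ⊢
  have h1 : HasSum (fun j => z ^ j • α j ζ) (f (z, ζ)) := by
    have := Complex.hasSum_taylorSeries_on_ball (r := 1) (c := 0) (hslice ζ hζ) (z := z) (by simpa using hz)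
    convert this using 2 with j
    rw [hgi j ζ hζ, sub_zero, smul_comm]
  have h2 : ∀ j, HasSum (fun k => ζ ^ k • a (j, k)) (α j ζ) := by
    intro j
    have := Complex.hasSum_taylorSeries_on_ball (r := 1) (c := 0) (hαd j) (z := ζ) (by simpa using hζ)
    convert this using 2 with k
    rw [sub_zero, smul_comm]
  have hsum : Summable (fun k : ℕ × ℕ => (z ^ k.1 * ζ ^ k.2) • a k) := by
    have hs : Summable (fun k : ℕ × ℕ => ‖z‖ ^ k.1 * ‖ζ‖ ^ k.2) :=
      (summable_geometric_of_lt_one (norm_nonneg _) hz).mul_of_nonneg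
        (summable_geometric_of_lt_one (norm_nonneg _) hζ) (fun _ => by positivity)
        (fun _ => by positivity)
    refine Summable.of_norm_bounded hs ?_
    intro k
    rw [norm_smul, norm_mul, norm_pow, norm_pow]
    exact mul_le_of_le_one_right (by positivity) (hab k)
  have h3 := hsum.hasSum.prod_fiberwise (g := fun j => z ^ j • α j ζ) (by
    intro j
    have := (h2 j).const_smul (z ^ j)
    simpa [smul_smul] using this)
  rw [← h3.unique h1]
  exact hsum.hasSum


theorem aux_geom (N : ℕ) (hN : 0 < N) (d : ℤ) :
    ∑ s ∈ Finset.range N, ((Complex.exp (2 * Real.pi * Complex.I / N)) ^ s) ^ d =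
      if (N : ℤ) ∣ d then (N : ℂ) else 0 := by
  have hp := Complex.isPrimitiveRoot_exp N hN.ne'
  set ω := Complex.exp (2 * Real.pi * Complex.I / N)
  have hre : ∀ s : ℕ, (ω ^ s) ^ d = (ω ^ d) ^ s := by
    intro s
    rw [← zpow_natCast, ← zpow_natCast, ← zpow_mul, ← zpow_mul, mul_comm]
  simp only [hre]
  split_ifs with h
  · have : ω ^ d = 1 := (hp.zpow_eq_one_iff_dvd d).2 h
    simp [this]
  · have h1 : ω ^ d ≠ 1 := fun h' => h ((hp.zpow_eq_one_iff_dvd d).1 h')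
    rw [geom_sum_eq h1]
    have : (ω ^ d) ^ N = 1 := by
      rw [← zpow_natCast, ← zpow_mul, mul_comm, zpow_mul, zpow_natCast, hp.pow_eq_one, one_zpow]
    simp [this]

theorem aux_parseval {V : Type*} [NormedAddCommGroup V] [InnerProductSpace ℂ V]
    (N : ℕ) (hN : 0 < N) (S : Finset (ℤ × ℤ)) (c : ℤ × ℤ → V)
    (hS : ∀ m ∈ S, ∀ m' ∈ S, (N : ℤ) ∣ m'.1 - m.1 → (N : ℤ) ∣ m'.2 - m.2 → m = m') :
    ∑ s ∈ Finset.range N, ∑ t ∈ Finset.range N,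
      ‖∑ m ∈ S, (((Complex.exp (2 * Real.pi * Complex.I / N)) ^ s) ^ m.1 *
        ((Complex.exp (2 * Real.pi * Complex.I / N)) ^ t) ^ m.2) • c m‖ ^ 2 =
      (N : ℝ) ^ 2 * ∑ m ∈ S, ‖c m‖ ^ 2 := by
  have hg := aux_geom N hN
  have hn : ‖Complex.exp (2 * Real.pi * Complex.I / N)‖ = 1 :=
    (Complex.isPrimitiveRoot_exp N hN.ne').norm'_eq_one hN.ne'
  set ω := Complex.exp (2 * Real.pi * Complex.I / N)
  have hω0 : ω ≠ 0 := by
    intro h; rw [h] at hn; simp at hn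
  have hconj : (starRingEnd ℂ) ω = ω⁻¹ := (Complex.inv_eq_conj hn).symm
  apply Complex.ofReal_injective
  push_cast
  have hsq : ∀ (v : V), ((‖v‖ : ℂ)) ^ 2 = inner ℂ v v := fun v => (inner_self_eq_norm_sq_to_K v).symm
  simp only [hsq, sum_inner, inner_sum, inner_smul_left, inner_smul_right]
  have hcomb : ∀ (s t : ℕ) (m m' : ℤ × ℤ), (ω ^ s) ^ m'.1 * (ω ^ t) ^ m'.2 *
      ((starRingEnd ℂ) ((ω ^ s) ^ m.1 * (ω ^ t) ^ m.2) * inner ℂ (c m) (c m')) =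
      ((ω ^ s) ^ (m'.1 - m.1) * (ω ^ t) ^ (m'.2 - m.2)) * inner ℂ (c m) (c m') := by
    intro s t m m'
    rw [map_mul, map_zpow₀, map_zpow₀, map_pow, map_pow, hconj,
      zpow_sub₀ (pow_ne_zero _ hω0), zpow_sub₀ (pow_ne_zero _ hω0), inv_pow, inv_pow, inv_zpow,
      inv_zpow]
    ring
  have : ∀ m ∈ S, ∀ m' ∈ S, ∑ s ∈ Finset.range N, ∑ t ∈ Finset.range N,
      ((ω ^ s) ^ (m'.1 - m.1) * (ω ^ t) ^ (m'.2 - m.2)) * inner ℂ (c m) (c m') =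
      if m = m' then (N : ℂ) ^ 2 * inner ℂ (c m) (c m') else 0 := by
    intro m hm m' hm'
    simp only [← Finset.sum_mul, ← Finset.mul_sum, hg]
    split_ifs with h1 h2 h3 h3 h3 h3 h3
    all_goals first
      | (subst h3; simp at *; done)
      | (exact absurd (hS m hm m' hm' ‹_› ‹_›) ‹_›)
      | simp [sq]
  have hswap : ∀ g : ℕ → ℕ → ℤ × ℤ → ℤ × ℤ → ℂ,
      ∑ s ∈ Finset.range N, ∑ t ∈ Finset.range N, ∑ m ∈ S, ∑ m' ∈ S, g s t m m' =
      ∑ m ∈ S, ∑ m' ∈ S, ∑ s ∈ Finset.range N, ∑ t ∈ Finset.range N, g s t m m' := by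
    intro g
    calc _ = ∑ s ∈ Finset.range N, ∑ m ∈ S, ∑ m' ∈ S, ∑ t ∈ Finset.range N, g s t m m' := by
          refine Finset.sum_congr rfl fun s _ => ?_
          rw [Finset.sum_comm]
          exact Finset.sum_congr rfl fun m _ => Finset.sum_comm
      _ = _ := by
          rw [Finset.sum_comm]
          exact Finset.sum_congr rfl fun m _ => Finset.sum_comm
  have hswap2 := hswap (fun s t m m' =>
    ((ω ^ s) ^ (m'.1 - m.1) * (ω ^ t) ^ (m'.2 - m.2)) * inner ℂ (c m) (c m'))
  calc _ = _ := by
        refine Finset.sum_congr rfl fun s _ => Finset.sum_congr rfl fun t _ => ?_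
        rw [Finset.sum_comm]
        refine Finset.sum_congr rfl fun m' _ => ?_
        rw [Finset.mul_sum]
        exact Finset.sum_congr rfl fun m _ => hcomb s t m m'
    _ = _ := hswap2
    _ = _ := by
        rw [Finset.mul_sum]
        refine Finset.sum_congr rfl fun m hm => ?_
        rw [Finset.sum_congr rfl (this m hm)]
        simp [hm]

theorem aux_tail {ι F : Type*} [NormedAddCommGroup F] (h : ι → F) (g : ι → ℝ) (s : F) (t : ℝ)
    (hs : HasSum h s) (hg : HasSum g t) (hb : ∀ k, ‖h k‖ ≤ g k) (B : Finset ι) :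
    ‖s - ∑ k ∈ B, h k‖ ≤ t - ∑ k ∈ B, g k := by
  classical
  have h1 : Filter.Tendsto (fun B' : Finset ι => ‖∑ k ∈ B', h k - ∑ k ∈ B, h k‖) Filter.atTop
      (nhds ‖s - ∑ k ∈ B, h k‖) := (Filter.Tendsto.sub_const hs _).norm
  have h2 : Filter.Tendsto (fun B' : Finset ι => ∑ k ∈ B', g k - ∑ k ∈ B, g k) Filter.atTop
      (nhds (t - ∑ k ∈ B, g k)) := Filter.Tendsto.sub_const hg _
  refine le_of_tendsto_of_tendsto h1 h2 ?_
  filter_upwards [Filter.eventually_ge_atTop B] with B' hB'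
  rw [← Finset.sum_sdiff hB', ← Finset.sum_sdiff hB', add_sub_cancel_right, add_sub_cancel_right]
  exact norm_sum_le_of_le _ fun k _ => hb k

theorem aux_poly {U Y : Type*} [NormedAddCommGroup U] [InnerProductSpace ℂ U]
    [NormedAddCommGroup Y] [InnerProductSpace ℂ Y]
    (P : ℤ × ℤ → (U →L[ℂ] Y)) (K : Finset (ℤ × ℤ)) (hK : ∀ k, k ∉ K → P k = 0) (C : ℝ)
    (hC : ∀ a b : ℂ, ‖a‖ = 1 → ‖b‖ = 1 → ‖∑ k ∈ K, (a ^ k.1 * b ^ k.2) • P k‖ ≤ C)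
    (x : ℤ × ℤ → U) (S M : Finset (ℤ × ℤ)) :
    ∑ m ∈ M, ‖∑ n ∈ S, P (n - m) (x n)‖ ^ 2 ≤ C ^ 2 * ∑ n ∈ S, ‖x n‖ ^ 2 := by
  classical
  have hC0 : 0 ≤ C := (norm_nonneg _).trans (hC 1 1 (by simp) (by simp))
  let M' : Finset (ℤ × ℤ) := M ∪ (S ×ˢ K).image (fun p => p.1 - p.2)
  obtain ⟨N, hN0, hN⟩ : ∃ N : ℕ, 0 < N ∧ ∀ m ∈ M' ∪ S, |m.1| < N ∧ |m.2| < N := by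
    refine ⟨∑ m ∈ M' ∪ S, (m.1.natAbs + m.2.natAbs) + 1, by omega, fun m hm => ?_⟩
    have := Finset.single_le_sum (f := fun m : ℤ × ℤ => m.1.natAbs + m.2.natAbs)
      (fun _ _ => Nat.zero_le _) hm
    rw [Int.abs_eq_natAbs, Int.abs_eq_natAbs]
    omega
  have hdist : ∀ T ⊆ M' ∪ S, ∀ m ∈ T, ∀ m' ∈ T, ((2 * N : ℕ) : ℤ) ∣ m'.1 - m.1 →
      ((2 * N : ℕ) : ℤ) ∣ m'.2 - m.2 → m = m' := by
    intro T hT m hm m' hm' h1 h2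
    have ha := hN m (hT hm)
    have hb := hN m' (hT hm')
    rw [abs_lt, abs_lt] at ha hb
    have e1 := Int.eq_zero_of_abs_lt_dvd h1 (by rw [abs_lt]; push_cast; constructor <;> linarith)
    have e2 := Int.eq_zero_of_abs_lt_dvd h2 (by rw [abs_lt]; push_cast; constructor <;> linarith)
    ext <;> omega
  have hpos : 0 < 2 * N := by omega
  have p1 := aux_parseval (2 * N) hpos M' (fun m => ∑ n ∈ S, P (n - m) (x n))
    (hdist M' Finset.subset_union_left)
  have p2 := aux_parseval (2 * N) hpos S x (hdist S Finset.subset_union_right)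
  have hn : ‖Complex.exp (2 * Real.pi * Complex.I / (2 * N : ℕ))‖ = 1 :=
    (Complex.isPrimitiveRoot_exp (2 * N) hpos.ne').norm'_eq_one hpos.ne'
  set ω := Complex.exp (2 * Real.pi * Complex.I / (2 * N : ℕ))
  have hpt : ∀ a b : ℂ, ‖a‖ = 1 → ‖b‖ = 1 →
      ‖∑ m ∈ M', (a ^ m.1 * b ^ m.2) • ∑ n ∈ S, P (n - m) (x n)‖ ^ 2 ≤
      C ^ 2 * ‖∑ n ∈ S, (a ^ n.1 * b ^ n.2) • x n‖ ^ 2 := by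
    intro a b ha hb
    have ha0 : a ≠ 0 := by rintro rfl; simp at ha
    have hb0 : b ≠ 0 := by rintro rfl; simp at hb
    have e : ∑ m ∈ M', (a ^ m.1 * b ^ m.2) • ∑ n ∈ S, P (n - m) (x n) =
        (∑ k ∈ K, ((a⁻¹) ^ k.1 * (b⁻¹) ^ k.2) • P k) (∑ n ∈ S, (a ^ n.1 * b ^ n.2) • x n) := by
      rw [map_sum]
      simp only [Finset.smul_sum]
      rw [Finset.sum_comm]
      refine Finset.sum_congr rfl fun n hn => ?_
      rw [sum_apply]
      have hinj : Set.InjOn (fun k : ℤ × ℤ => n - k) (K : Set (ℤ × ℤ)) :=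
        fun k _ k' _ h => by simpa using h
      have : ∑ k ∈ K, (((a⁻¹) ^ k.1 * (b⁻¹) ^ k.2) • P k) ((a ^ n.1 * b ^ n.2) • x n) =
          ∑ m ∈ K.image (fun k => n - k), (a ^ m.1 * b ^ m.2) • P (n - m) (x n) := by
        rw [Finset.sum_image hinj]
        refine Finset.sum_congr rfl fun k _ => ?_
        rw [map_smul, smul_apply, smul_smul, sub_sub_cancel, Prod.fst_sub,
          Prod.snd_sub, zpow_sub₀ ha0, zpow_sub₀ hb0, inv_zpow, inv_zpow]
        congr 1
        ring
      rw [this]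
      symm
      apply Finset.sum_subset
      · intro m hm
        obtain ⟨k, hk, rfl⟩ := Finset.mem_image.1 hm
        exact Finset.mem_union_right _ (Finset.mem_image.2 ⟨(n, k), by simp [hn, hk], rfl⟩)
      · intro m _ hm
        have : n - m ∉ K := fun h => hm (Finset.mem_image.2 ⟨n - m, h, by simp⟩)
        simp [hK _ this]
    rw [e, ← mul_pow]
    refine pow_le_pow_left₀ (norm_nonneg _) ?_ 2
    refine (ContinuousLinearMap.le_opNorm _ _).trans ?_
    gcongr
    exact hC _ _ (by simp [ha]) (by simp [hb])
  have hfin : ((2 * N : ℕ) : ℝ) ^ 2 * ∑ m ∈ M', ‖∑ n ∈ S, P (n - m) (x n)‖ ^ 2 ≤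
      ((2 * N : ℕ) : ℝ) ^ 2 * (C ^ 2 * ∑ n ∈ S, ‖x n‖ ^ 2) := by
    rw [mul_left_comm, ← p1, ← p2, Finset.mul_sum]
    refine Finset.sum_le_sum fun s _ => ?_
    rw [Finset.mul_sum]
    refine Finset.sum_le_sum fun t _ => ?_
    exact hpt _ _ (by simp [hn]) (by simp [hn])
  have hNpos : (0:ℝ) < ((2 * N : ℕ) : ℝ) ^ 2 := by positivity
  refine le_trans ?_ (le_of_mul_le_mul_left hfin hNpos)
  exact Finset.sum_le_sum_of_subset_of_nonneg Finset.subset_union_left fun _ _ _ => by positivity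

/-- two-sided coefficient sequence -/
def auxF {F : Type*} [Zero F] (a : ℕ × ℕ → F) (k : ℤ × ℤ) : F :=
  if 0 ≤ k.1 ∧ 0 ≤ k.2 then a (k.1.toNat, k.2.toNat) else 0

theorem aux_contr {U Y : Type*} [NormedAddCommGroup U] [InnerProductSpace ℂ U]
    [NormedAddCommGroup Y] [InnerProductSpace ℂ Y]
    (f : ℂ × ℂ → (U →L[ℂ] Y)) (hb : ∀ w ∈ bidisk, ‖f w‖ ≤ 1)
    (a : ℕ × ℕ → (U →L[ℂ] Y)) (ha : ∀ k, ‖a k‖ ≤ 1)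
    (hs : ∀ w ∈ bidisk, HasSum (fun k : ℕ × ℕ => (w.1 ^ k.1 * w.2 ^ k.2) • a k) (f w))
    (x : ℤ × ℤ → U) (S M : Finset (ℤ × ℤ)) :
    ∑ m ∈ M, ‖∑ n ∈ S, auxF a (n - m) (x n)‖ ^ 2 ≤ ∑ n ∈ S, ‖x n‖ ^ 2 := by
  classical
  have key : ∀ r : ℝ, 0 < r → r < 1 → ∀ ε : ℝ, 0 < ε →
      ∑ m ∈ M, ‖∑ n ∈ S, ((r : ℂ) ^ ((n - m).1.toNat + (n - m).2.toNat)) • auxF a (n - m) (x n)‖ ^ 2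
        ≤ (1 + ε) ^ 2 * ∑ n ∈ S, ‖x n‖ ^ 2 := by
    intro r hr0 hr1 ε hε
    have hg : Summable (fun k : ℕ × ℕ => r ^ k.1 * r ^ k.2) :=
      (summable_geometric_of_lt_one hr0.le hr1).mul_of_nonneg
        (summable_geometric_of_lt_one hr0.le hr1) (fun _ => by positivity)
        (fun _ => by positivity)
    let B0 : Finset (ℕ × ℕ) := (S ×ˢ M).image (fun p => ((p.1 - p.2).1.toNat, (p.1 - p.2).2.toNat))
    obtain ⟨B, hBB, hBε⟩ : ∃ B : Finset (ℕ × ℕ), B0 ⊆ B ∧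
        (∑' k : ℕ × ℕ, r ^ k.1 * r ^ k.2) - ∑ k ∈ B, r ^ k.1 * r ^ k.2 < ε := by
      have h1 : ∀ᶠ B : Finset (ℕ × ℕ) in Filter.atTop, (∑' k : ℕ × ℕ, r ^ k.1 * r ^ k.2) - ε <
          ∑ k ∈ B, r ^ k.1 * r ^ k.2 := hg.hasSum.eventually (lt_mem_nhds (by linarith))
      obtain ⟨B, h2, h3⟩ := (h1.and (Filter.eventually_ge_atTop B0)).exists
      exact ⟨B, h3, by linarith⟩
    let K : Finset (ℤ × ℤ) := B.image (fun k => ((k.1 : ℤ), (k.2 : ℤ)))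
    let P : ℤ × ℤ → (U →L[ℂ] Y) := fun k =>
      if k ∈ K then ((r : ℂ) ^ (k.1.toNat + k.2.toNat)) • auxF a k else 0
    have hmain := aux_poly P K (fun k hk => if_neg hk) (1 + ε) ?_ x S M
    · refine le_trans (le_of_eq ?_) hmain
      refine Finset.sum_congr rfl fun m hm => ?_
      congr 2
      refine Finset.sum_congr rfl fun n hn => ?_
      by_cases h : 0 ≤ (n - m).1 ∧ 0 ≤ (n - m).2
      · have : n - m ∈ K := by
          refine Finset.mem_image.2 ⟨((n - m).1.toNat, (n - m).2.toNat), hBB ?_, ?_⟩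
          · exact Finset.mem_image.2 ⟨(n, m), by simp [hn, hm], rfl⟩
          · ext
            · exact Int.toNat_of_nonneg h.1
            · exact Int.toNat_of_nonneg h.2
        simp [P, this]
      · have : auxF a (n - m) = 0 := if_neg h
        simp [P, this]
    · intro α β hα hβ
      have hw : ((r : ℂ) * α, (r : ℂ) * β) ∈ bidisk := by
        constructor <;> simp [hα, hβ, abs_of_pos hr0, hr1]
      have ht := aux_tail _ _ _ _ (hs _ hw) hg.hasSum (fun k => by
        rw [norm_smul, norm_mul, norm_pow, norm_pow]
        simp only [norm_mul, hα, hβ, Complex.norm_real, Real.norm_eq_abs, abs_of_pos hr0, mul_one]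
        exact mul_le_of_le_one_right (by positivity) (ha k)) B
      have he : ∑ k ∈ K, (α ^ k.1 * β ^ k.2) • P k =
          ∑ k ∈ B, ((((r : ℂ) * α)) ^ k.1 * ((r : ℂ) * β) ^ k.2) • a k := by
        rw [Finset.sum_image (fun k _ k' _ h => by simpa [Prod.ext_iff] using h)]
        refine Finset.sum_congr rfl fun k hk => ?_
        have : (((k.1 : ℤ), (k.2 : ℤ)) : ℤ × ℤ) ∈ K := Finset.mem_image_of_mem _ hk
        simp only [P, if_pos this, auxF]
        simp only [Int.natCast_nonneg, and_self, if_true, Int.toNat_natCast, zpow_natCast, smul_smul]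
        congr 1
        ring
      rw [he]
      have hfw := hb _ hw
      have h3 := norm_sub_norm_le (∑ k ∈ B, ((((r : ℂ) * α)) ^ k.1 * ((r : ℂ) * β) ^ k.2) • a k)
        (f ((r : ℂ) * α, (r : ℂ) * β))
      rw [norm_sub_rev] at h3
      linarith
  have key2 : ∀ r : ℝ, 0 < r → r < 1 →
      ∑ m ∈ M, ‖∑ n ∈ S, ((r : ℂ) ^ ((n - m).1.toNat + (n - m).2.toNat)) • auxF a (n - m) (x n)‖ ^ 2
        ≤ ∑ n ∈ S, ‖x n‖ ^ 2 := by
    intro r h0 h1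
    have ht : Filter.Tendsto (fun ε : ℝ => (1 + ε) ^ 2 * ∑ n ∈ S, ‖x n‖ ^ 2)
        (nhdsWithin 0 (Set.Ioi 0)) (nhds ((1 + 0) ^ 2 * ∑ n ∈ S, ‖x n‖ ^ 2)) := by
      apply Filter.Tendsto.mono_left _ nhdsWithin_le_nhds
      apply Continuous.tendsto
      fun_prop
    rw [add_zero, one_pow, one_mul] at ht
    refine ge_of_tendsto ht ?_
    filter_upwards [self_mem_nhdsWithin] with ε hε
    exact key r h0 h1 ε hε
  have ht : Filter.Tendsto (fun r : ℝ => ∑ m ∈ M,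
      ‖∑ n ∈ S, ((r : ℂ) ^ ((n - m).1.toNat + (n - m).2.toNat)) • auxF a (n - m) (x n)‖ ^ 2)
      (nhdsWithin 1 (Set.Iio 1)) (nhds (∑ m ∈ M,
      ‖∑ n ∈ S, (((1 : ℝ) : ℂ) ^ ((n - m).1.toNat + (n - m).2.toNat)) • auxF a (n - m) (x n)‖ ^ 2)) := by
    apply Filter.Tendsto.mono_left _ nhdsWithin_le_nhds
    apply Continuous.tendsto (f := fun r : ℝ => ∑ m ∈ M,
      ‖∑ n ∈ S, ((r : ℂ) ^ ((n - m).1.toNat + (n - m).2.toNat)) • auxF a (n - m) (x n)‖ ^ 2)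
    fun_prop
  simp only [Complex.ofReal_one, one_pow, one_smul] at ht
  refine le_of_tendsto ht ?_
  filter_upwards [Ioo_mem_nhdsLT (show (0:ℝ) < 1 by norm_num)] with r hr
  exact key2 r hr.1 hr.2


/-- square summable families indexed by `ℤ × ℤ` -/
abbrev AuxL (V : Type*) [NormedAddCommGroup V] : Type _ := lp (fun _ : ℤ × ℤ => V) 2

section auxlp
variable {V : Type*} [NormedAddCommGroup V] [InnerProductSpace ℂ V]

theorem aux_memlp {W : Type*} [NormedAddCommGroup W] (x : ℤ × ℤ → W) :
    Memℓp x 2 ↔ Summable (fun n => ‖x n‖ ^ 2) := by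
  rw [memℓp_gen_iff (by simp)]
  simp

/-- build a square summable family -/
def auxMk {W : Type*} [NormedAddCommGroup W] (x : ℤ × ℤ → W) (h : Summable (fun n => ‖x n‖ ^ 2)) :
    AuxL W := ⟨x, (aux_memlp x).2 h⟩

theorem auxMk_apply {W : Type*} [NormedAddCommGroup W] (x : ℤ × ℤ → W)
    (h : Summable (fun n => ‖x n‖ ^ 2)) (n : ℤ × ℤ) : auxMk x h n = x n := rfl

theorem auxAdd_apply {W : Type*} [NormedAddCommGroup W] (x y : AuxL W) (n : ℤ × ℤ) :
    (x + y) n = x n + y n := rfl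

theorem auxSmul_apply {W : Type*} [NormedAddCommGroup W] [InnerProductSpace ℂ W]
    (c : ℂ) (x : AuxL W) (n : ℤ × ℤ) : (c • x) n = c • x n := rfl

theorem aux_ext {W : Type*} [NormedAddCommGroup W] {x y : AuxL W} (h : ∀ n, x n = y n) : x = y :=
  lp.ext (funext h)

theorem aux_hasSum_sq (x : AuxL V) : HasSum (fun n => ‖x n‖ ^ 2) (‖x‖ ^ 2) := by
  have h := lp.hasSum_inner (𝕜 := ℂ) x x
  have h2 := Complex.hasSum_re h
  convert h2 using 1
  · funext n
    exact (norm_sq_eq_re_inner (𝕜 := ℂ) (x n))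
  · exact (norm_sq_eq_re_inner (𝕜 := ℂ) x)

open Classical in
/-- coordinate projection -/
def auxPr (S : Set (ℤ × ℤ)) : AuxL V →L[ℂ] AuxL V :=
  LinearMap.mkContinuous
    { toFun := fun x => auxMk (fun n => if n ∈ S then x n else 0) (by
        refine Summable.of_nonneg_of_le (fun _ => by positivity) (fun n => ?_) (aux_hasSum_sq x).summable
        split_ifs <;> simp)
      map_add' := by
        intro x y; refine aux_ext fun n => ?_
        simp only [auxAdd_apply, auxMk_apply]
        by_cases h : n ∈ S <;> simp [h]
      map_smul' := by
        intro x y; refine aux_ext fun n => ?_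
        simp only [auxSmul_apply, auxMk_apply, RingHom.id_apply]
        by_cases h : n ∈ S <;> simp [h] }
    1 (by
      intro x
      rw [one_mul]
      refine (pow_le_pow_iff_left₀ (norm_nonneg _) (norm_nonneg _) two_ne_zero).1 ?_
      refine hasSum_le (fun n => ?_) (aux_hasSum_sq _) (aux_hasSum_sq x)
      simp only [LinearMap.coe_mk, AddHom.coe_mk, auxMk_apply]
      split_ifs <;> simp)

open Classical in
theorem auxPr_apply (S : Set (ℤ × ℤ)) (x : AuxL V) (n : ℤ × ℤ) :
    auxPr S x n = if n ∈ S then x n else 0 := rfl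

theorem auxPr_pos {S : Set (ℤ × ℤ)} {x : AuxL V} {n : ℤ × ℤ} (h : n ∈ S) :
    auxPr S x n = x n := by
  classical
  rw [auxPr_apply]; exact if_pos h

theorem auxPr_neg {S : Set (ℤ × ℤ)} {x : AuxL V} {n : ℤ × ℤ} (h : n ∉ S) :
    auxPr S x n = 0 := by
  classical
  rw [auxPr_apply]; exact if_neg h

theorem aux_sh_hasSum (d : ℤ × ℤ) (x : AuxL V) :
    HasSum (fun n => ‖x (n + d)‖ ^ 2) (‖x‖ ^ 2) := by
  have h := (Equiv.addRight d).hasSum_iff.2 (aux_hasSum_sq x)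
  exact h

/-- shift -/
def auxSh (d : ℤ × ℤ) : AuxL V →L[ℂ] AuxL V :=
  LinearMap.mkContinuous
    { toFun := fun x => auxMk (fun n => x (n + d))
        (aux_sh_hasSum d x).summable
      map_add' := fun _ _ => rfl
      map_smul' := fun _ _ => rfl }
    1 (by
      intro x
      rw [one_mul]
      refine (pow_le_pow_iff_left₀ (norm_nonneg _) (norm_nonneg _) two_ne_zero).1 ?_
      refine le_of_eq (HasSum.unique (aux_hasSum_sq _) ?_)
      exact aux_sh_hasSum d x)

theorem auxSh_apply (d : ℤ × ℤ) (x : AuxL V) (n : ℤ × ℤ) : auxSh d x n = x (n + d) := rfl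

theorem auxSh_norm (d : ℤ × ℤ) (x : AuxL V) : ‖auxSh d x‖ = ‖x‖ := by
  refine (pow_left_inj₀ (norm_nonneg _) (norm_nonneg _) two_ne_zero).1 ?_
  refine HasSum.unique (aux_hasSum_sq _) ?_
  exact aux_sh_hasSum d x

theorem auxPr_norm_le (S : Set (ℤ × ℤ)) (x : AuxL V) : ‖auxPr S x‖ ≤ ‖x‖ := by
  refine (pow_le_pow_iff_left₀ (norm_nonneg _) (norm_nonneg _) two_ne_zero).1 ?_
  refine hasSum_le (fun n => ?_) (aux_hasSum_sq _) (aux_hasSum_sq x)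
  rw [auxPr_apply]
  split_ifs <;> simp

theorem auxPr_norm_add (S S' : Set (ℤ × ℤ)) (h : Disjoint S S') (x : AuxL V) :
    ‖auxPr (S ∪ S') x‖ ^ 2 = ‖auxPr S x‖ ^ 2 + ‖auxPr S' x‖ ^ 2 := by
  refine HasSum.unique (aux_hasSum_sq _) ?_
  convert (aux_hasSum_sq (auxPr S x)).add (aux_hasSum_sq (auxPr S' x)) using 2 with n
  by_cases h1 : n ∈ S
  · have h2 : n ∉ S' := Set.disjoint_left.1 h h1
    rw [auxPr_pos (Or.inl h1), auxPr_pos h1, auxPr_neg h2]; simp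
  · by_cases h2 : n ∈ S'
    · rw [auxPr_pos (Or.inr h2), auxPr_neg h1, auxPr_pos h2]; simp
    · rw [auxPr_neg (fun hu => hu.elim h1 h2), auxPr_neg h1, auxPr_neg h2]; simp

theorem auxPr_symm (S : Set (ℤ × ℤ)) (x y : AuxL V) :
    inner ℂ (auxPr S x) y = inner ℂ x (auxPr S y) := by
  refine HasSum.unique (lp.hasSum_inner _ _) ?_
  convert lp.hasSum_inner (𝕜 := ℂ) x (auxPr S y) using 2 with n
  simp only [auxPr_apply]
  split_ifs <;> simp

end auxlp

theorem aux_exists_T {U Y : Type*} [NormedAddCommGroup U] [InnerProductSpace ℂ U]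
    [NormedAddCommGroup Y] [InnerProductSpace ℂ Y] [CompleteSpace Y]
    (F : ℤ × ℤ → (U →L[ℂ] Y))
    (hF : ∀ (x : ℤ × ℤ → U) (S M : Finset (ℤ × ℤ)),
      ∑ m ∈ M, ‖∑ n ∈ S, F (n - m) (x n)‖ ^ 2 ≤ ∑ n ∈ S, ‖x n‖ ^ 2) :
    ∃ T : AuxL U →L[ℂ] AuxL Y, (∀ x, ‖T x‖ ≤ ‖x‖) ∧
      ∀ x m, HasSum (fun n => F (n - m) (x n)) (T x m) := by
  classical
  let e : (ℤ × ℤ →₀ U) →ₗ[ℂ] AuxL U :=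
    { toFun := fun x => auxMk (fun n => x n)
        (summable_of_ne_finset_zero (s := x.support) (fun n hn => by
          simp [Finsupp.notMem_support_iff.1 hn]))
      map_add' := fun _ _ => rfl
      map_smul' := fun _ _ => rfl }
  have he : ∀ x, ‖e x‖ ^ 2 = ∑ n ∈ x.support, ‖x n‖ ^ 2 := by
    intro x
    refine HasSum.unique (aux_hasSum_sq _) ?_
    exact hasSum_sum_of_ne_finset_zero (fun n hn => by
      have : e x n = 0 := Finsupp.notMem_support_iff.1 hn
      simp [this])
  let g : (ℤ × ℤ →₀ U) →ₗ[ℂ] AuxL Y :=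
    { toFun := fun x => auxMk (fun m => x.sum fun n u => F (n - m) u)
        (summable_of_sum_le (fun _ => by positivity) (fun M => hF x x.support M))
      map_add' := by
        intro x y; refine aux_ext fun m => ?_
        exact Finsupp.sum_add_index' (by simp) (by simp)
      map_smul' := by
        intro c x; refine aux_ext fun m => ?_
        simp only [auxSmul_apply, auxMk_apply, RingHom.id_apply]
        rw [Finsupp.sum_smul_index' (by simp), Finsupp.smul_sum]
        simp }
  have hg : ∀ x, ‖g x‖ ≤ 1 * ‖e x‖ := by
    intro x
    rw [one_mul]
    refine (pow_le_pow_iff_left₀ (norm_nonneg _) (norm_nonneg _) two_ne_zero).1 ?_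
    rw [he]
    exact (aux_hasSum_sq (g x)).summable.tsum_le_of_sum_le (fun M => hF x x.support M) |>
      (le_of_eq (aux_hasSum_sq (g x)).tsum_eq.symm).trans
  have hsingle : ∀ n u, e (Finsupp.single n u) = lp.single 2 n u := by
    intro n u; ext m
    have : e (Finsupp.single n u) m = Finsupp.single n u m := rfl
    rw [this, lp.single_apply, Finsupp.single_apply, Pi.single_apply]
    simp [eq_comm]
  have hd : DenseRange e := by
    intro x
    refine mem_closure_of_tendsto (lp.hasSum_single (by simp) x) ?_
    refine Filter.Eventually.of_forall fun s => ?_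
    refine ⟨∑ n ∈ s, Finsupp.single n (x n), ?_⟩
    simp [hsingle]
  refine ⟨g.extendOfNorm e, fun x => ?_, fun x m => ?_⟩
  · simpa using LinearMap.norm_extendOfNorm_apply_le hd 1 hg x
  · have h1 := (lp.hasSum_single (by simp) x).mapL (g.extendOfNorm e)
    have h2 := h1.mapL (lp.evalCLM ℂ (fun _ : ℤ × ℤ => Y) 2 m)
    change HasSum _ (lp.evalCLM ℂ (fun _ : ℤ × ℤ => Y) 2 m (g.extendOfNorm e x))
    convert h2 using 2 with n
    rw [← hsingle, LinearMap.extendOfNorm_eq hd ⟨1, hg⟩]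
    symm
    exact Finsupp.sum_single_index (by simp)


theorem aux_sqrt_form {E : Type*} [NormedAddCommGroup E] [InnerProductSpace ℂ E] [CompleteSpace E]
    (S : E →L[ℂ] E) (φ : E → E → ℂ) (hφ : ∀ x y, inner ℂ x (S y) = φ x y)
    (hsym : ∀ x y, (starRingEnd ℂ) (φ y x) = φ x y) (hpos : ∀ x, 0 ≤ (φ x x).re) :
    ∃ D : E →L[ℂ] E, ∀ x y, inner ℂ (D x) (D y) = φ x y := by
  obtain ⟨D, hD⟩ := aux_sqrt S (by
    rw [ContinuousLinearMap.isSelfAdjoint_iff_isSymmetric]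
    intro x y
    change inner ℂ (S x) y = inner ℂ x (S y)
    rw [hφ, ← hsym, ← hφ, inner_conj_symm]) (fun x => by rw [hφ]; exact hpos x)
  exact ⟨D, fun x y => by rw [hD, hφ]⟩

theorem aux_short {E : Type*} [NormedAddCommGroup E] [InnerProductSpace ℂ E] [CompleteSpace E]
    (B : E →L[ℂ] E) : ∃ P : E →L[ℂ] E, (∀ v y, ‖P v‖ ≤ ‖v + B y‖) ∧
      ∀ v, ∀ ε > 0, ∃ y, ‖v + B y‖ ≤ ‖P v‖ + ε := by
  let W : Submodule ℂ E := (LinearMap.range (B : E →ₗ[ℂ] E)).topologicalClosure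
  have : CompleteSpace W := (Submodule.isClosed_topologicalClosure _).completeSpace_coe
  have hB : ∀ y, B y ∈ W := fun y => Submodule.le_topologicalClosure _ ⟨y, rfl⟩
  refine ⟨Wᗮ.starProjection, fun v y => ?_, fun v ε hε => ?_⟩
  · have h1 : Wᗮ.starProjection (B y) = 0 := by
      rw [Submodule.starProjection_apply_eq_zero_iff]
      exact Submodule.le_orthogonal_orthogonal W (hB y)
    have h2 : Wᗮ.starProjection v = Wᗮ.starProjection (v + B y) := by rw [map_add, h1, add_zero]
    rw [h2]
    exact Submodule.norm_starProjection_apply_le _ _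
  · have hv : W.starProjection v + Wᗮ.starProjection v = v :=
      Submodule.starProjection_add_starProjection_orthogonal v
    have hm : W.starProjection v ∈ closure (Set.range B) := Submodule.starProjection_apply_mem W v
    obtain ⟨z, ⟨y, rfl⟩, hy⟩ := Metric.mem_closure_iff.1 hm ε hε
    refine ⟨-y, ?_⟩
    rw [dist_eq_norm] at hy
    calc ‖v + B (-y)‖ = ‖Wᗮ.starProjection v + (W.starProjection v - B y)‖ := by
          rw [map_neg]; congr 1; nth_rewrite 1 [← hv]; abel
      _ ≤ _ := (norm_add_le _ _).trans (by linarith)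

/-- quadrant -/
def auxq : Set (ℤ × ℤ) := {n | 0 ≤ n.1 ∧ 0 ≤ n.2}
/-- negative strip -/
def auxn : Set (ℤ × ℤ) := {n | n.1 < 0 ∧ 0 ≤ n.2}

theorem aux_mem_h (n : ℤ × ℤ) : n ∈ auxq ∪ auxn ↔ 0 ≤ n.2 := by
  simp only [auxq, auxn, Set.mem_union, Set.mem_ofPred_eq]; omega

theorem aux_disj : Disjoint auxq auxn := by
  rw [Set.disjoint_left]
  rintro n ⟨h1, _⟩ ⟨h2, _⟩
  omega

section agler
variable {U Y : Type*} [NormedAddCommGroup U] [InnerProductSpace ℂ U] [CompleteSpace U]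
  [NormedAddCommGroup Y] [InnerProductSpace ℂ Y] [CompleteSpace Y]

theorem auxPr_idem {V : Type*} [NormedAddCommGroup V] [InnerProductSpace ℂ V]
    (S : Set (ℤ × ℤ)) (x : AuxL V) : auxPr S (auxPr S x) = auxPr S x := by
  refine aux_ext fun n => ?_
  by_cases h : n ∈ S
  · rw [auxPr_pos h]
  · rw [auxPr_neg h, auxPr_neg h]

theorem auxPr_congr {V : Type*} [NormedAddCommGroup V] [InnerProductSpace ℂ V]
    {S : Set (ℤ × ℤ)} {x y : AuxL V} (h : ∀ n ∈ S, x n = y n) : auxPr S x = auxPr S y := by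
  refine aux_ext fun n => ?_
  by_cases hn : n ∈ S
  · rw [auxPr_pos hn, auxPr_pos hn, h n hn]
  · rw [auxPr_neg hn, auxPr_neg hn]

theorem auxPr_h_sh {V : Type*} [NormedAddCommGroup V] [InnerProductSpace ℂ V] (z : AuxL V) :
    auxPr (auxq ∪ auxn) (auxSh (1, 0) z) = auxSh (1, 0) (auxPr (auxq ∪ auxn) z) := by
  refine aux_ext fun n => ?_
  rw [auxSh_apply]
  have hiff : n + (1, 0) ∈ auxq ∪ auxn ↔ n ∈ auxq ∪ auxn := by
    rw [aux_mem_h, aux_mem_h]; simp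
  by_cases hn : n ∈ auxq ∪ auxn
  · rw [auxPr_pos hn, auxPr_pos (hiff.2 hn)]; rfl
  · rw [auxPr_neg hn, auxPr_neg (fun h => hn (hiff.1 h))]


theorem auxT_sh (F : ℤ × ℤ → (U →L[ℂ] Y))
    (T : AuxL U →L[ℂ] AuxL Y)
    (hT : ∀ x m, HasSum (fun n => F (n - m) (x n)) (T x m))
    (d : ℤ × ℤ) (x : AuxL U) : T (auxSh d x) = auxSh d (T x) := by
  refine aux_ext fun m => ?_
  rw [auxSh_apply]
  refine HasSum.unique (hT _ m) ?_
  have h := (Equiv.addRight d).hasSum_iff.2 (hT x (m + d))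
  convert h using 2 with n
  simp only [Function.comp, Equiv.coe_addRight, add_sub_add_right_eq_sub]
  rfl

theorem auxT_caus (F : ℤ × ℤ → (U →L[ℂ] Y))
    (hF0 : ∀ k, ¬ (0 ≤ k.1 ∧ 0 ≤ k.2) → F k = 0)
    (T : AuxL U →L[ℂ] AuxL Y)
    (hT : ∀ x m, HasSum (fun n => F (n - m) (x n)) (T x m))
    (S : Set (ℤ × ℤ)) (hS : ∀ n ∈ S, ∀ m, n.1 ≤ m.1 → n.2 ≤ m.2 → m ∈ S)
    (x y : AuxL U) (hxy : ∀ n ∈ S, x n = y n) : auxPr S (T x) = auxPr S (T y) := by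
  refine auxPr_congr fun m hm => ?_
  refine HasSum.unique (hT x m) ?_
  convert hT y m using 2 with n
  by_cases h : 0 ≤ (n - m).1 ∧ 0 ≤ (n - m).2
  · rw [hxy n (hS m hm n (by simpa using h.1) (by simpa using h.2))]
  · rw [hF0 _ h]; rfl

theorem auxq_up : ∀ n ∈ auxq, ∀ m : ℤ × ℤ, n.1 ≤ m.1 → n.2 ≤ m.2 → m ∈ auxq := by
  rintro n ⟨h1, h2⟩ m h3 h4
  exact ⟨h1.trans h3, h2.trans h4⟩

theorem auxh_up : ∀ n ∈ auxq ∪ auxn, ∀ m : ℤ × ℤ, n.1 ≤ m.1 → n.2 ≤ m.2 → m ∈ auxq ∪ auxn := by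
  intro n hn m _ h4
  rw [aux_mem_h] at hn ⊢
  exact hn.trans h4

section defect
variable (T : AuxL U →L[ℂ] AuxL Y)

/-- defect operator -/
def auxD (S : Set (ℤ × ℤ)) : AuxL U →L[ℂ] AuxL U :=
  auxPr S - (ContinuousLinearMap.adjoint T) ∘L auxPr S ∘L T

/-- defect form -/
def auxφ (S : Set (ℤ × ℤ)) (x y : AuxL U) : ℂ :=
  inner ℂ (auxPr S x) (auxPr S y) - inner ℂ (auxPr S (T x)) (auxPr S (T y))

theorem auxD_inner (S : Set (ℤ × ℤ)) (x y : AuxL U) :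
    inner ℂ x (auxD T S y) = auxφ T S x y := by
  have h1 : inner ℂ x (auxPr S y) = inner ℂ (auxPr S x) (auxPr S y) := by
    rw [auxPr_symm, auxPr_idem]
  have h2 : inner ℂ (T x) (auxPr S (T y)) = inner ℂ (auxPr S (T x)) (auxPr S (T y)) := by
    rw [auxPr_symm, auxPr_idem]
  simp only [auxD, auxφ, sub_apply, comp_apply, inner_sub_right,
    ContinuousLinearMap.adjoint_inner_right, h1, h2]

theorem auxφ_symm (S : Set (ℤ × ℤ)) (x y : AuxL U) :
    (starRingEnd ℂ) (auxφ T S y x) = auxφ T S x y := by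
  simp only [auxφ, map_sub, inner_conj_symm]

theorem auxφ_self (S : Set (ℤ × ℤ)) (x : AuxL U) :
    (auxφ T S x x).re = ‖auxPr S x‖ ^ 2 - ‖auxPr S (T x)‖ ^ 2 := by
  rw [auxφ, Complex.sub_re]
  congr 1
  · exact (norm_sq_eq_re_inner (𝕜 := ℂ) _).symm
  · exact (norm_sq_eq_re_inner (𝕜 := ℂ) _).symm

end defect

theorem aux_key (F : ℤ × ℤ → (U →L[ℂ] Y))
    (hF0 : ∀ k, ¬ (0 ≤ k.1 ∧ 0 ≤ k.2) → F k = 0)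
    (T : AuxL U →L[ℂ] AuxL Y) (hT1 : ∀ x, ‖T x‖ ≤ ‖x‖)
    (hT : ∀ x m, HasSum (fun n => F (n - m) (x n)) (T x m)) : ∃ R : AuxL U →L[ℂ] AuxL U,
    (∀ x, R (auxPr auxq x) = R x) ∧
    (∀ x, ‖R (auxSh (1, 0) x)‖ ≤ ‖R x‖) ∧
    (∀ x, (auxφ T auxq (auxSh (0, 1) x) (auxSh (0, 1) x)).re - ‖R (auxSh (0, 1) x)‖ ^ 2 ≤
      (auxφ T auxq x x).re - ‖R x‖ ^ 2) := by
  obtain ⟨G, hG⟩ := aux_sqrt_form (auxD T (auxq ∪ auxn)) _ (auxD_inner T (auxq ∪ auxn))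
    (auxφ_symm T _) (by
      intro x
      rw [auxφ_self]
      have h1 : auxPr (auxq ∪ auxn) (T x) = auxPr (auxq ∪ auxn) (T (auxPr (auxq ∪ auxn) x)) :=
        auxT_caus F hF0 T hT _ auxh_up _ _ (fun n hn => (auxPr_pos hn).symm)
      have h2 : ‖auxPr (auxq ∪ auxn) (T x)‖ ≤ ‖auxPr (auxq ∪ auxn) x‖ := by
        rw [h1]
        exact (auxPr_norm_le _ _).trans (hT1 _)
      have := pow_le_pow_left₀ (norm_nonneg _) h2 2
      linarith)
  have hGn : ∀ x, ‖G x‖ ^ 2 = ‖auxPr (auxq ∪ auxn) x‖ ^ 2 - ‖auxPr (auxq ∪ auxn) (T x)‖ ^ 2 := by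
    intro x
    rw [← auxφ_self, ← hG]
    exact norm_sq_eq_re_inner (𝕜 := ℂ) _
  obtain ⟨P, hP1, hP2⟩ := aux_short (G ∘L auxPr auxn)
  have hR1 : ∀ x y, ‖P (G (auxPr auxq x))‖ ≤ ‖G (auxPr auxq x + auxPr auxn y)‖ := by
    intro x y
    rw [map_add]
    exact hP1 _ y
  have hR2 : ∀ x, ∀ ε > 0, ∃ y, ‖G (auxPr auxq x + auxPr auxn y)‖ ≤ ‖P (G (auxPr auxq x))‖ + ε := by
    intro x ε hε
    obtain ⟨y, hy⟩ := hP2 (G (auxPr auxq x)) ε hε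
    exact ⟨y, by rw [map_add]; exact hy⟩
  refine ⟨P ∘L G ∘L auxPr auxq, ?_, ?_, ?_⟩
  · intro x
    simp only [comp_apply, auxPr_idem]
  · intro x
    simp only [comp_apply]
    refine le_of_forall_pos_le_add fun ε hε => ?_
    obtain ⟨y, hy⟩ := hR2 x ε hε
    refine le_trans ?_ hy
    set v := auxPr auxq x + auxPr auxn y with hv
    refine (hR1 _ (auxSh (1, 0) v)).trans ?_
    have e : auxPr auxq (auxSh (1, 0) x) + auxPr auxn (auxSh (1, 0) v) = auxSh (1, 0) v := by
      refine aux_ext fun n => ?_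
      rw [auxAdd_apply, auxSh_apply]
      by_cases h1 : n ∈ auxq
      · have h2 : n ∉ auxn := Set.disjoint_left.1 aux_disj h1
        have h3 : n + (1, 0) ∈ auxq := auxq_up n h1 _ (by simp) (by simp)
        have h4 : n + (1, 0) ∉ auxn := Set.disjoint_left.1 aux_disj h3
        rw [auxPr_pos h1, auxPr_neg h2, hv, auxAdd_apply, auxPr_pos h3, auxPr_neg h4]
        rfl
      · by_cases h2 : n ∈ auxn
        · rw [auxPr_neg h1, auxPr_pos h2, zero_add]
          rfl
        · have h3 : n + (1, 0) ∉ auxq ∪ auxn := by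
            have : n ∉ auxq ∪ auxn := fun h => h.elim h1 h2
            rw [aux_mem_h] at this ⊢
            simpa using this
          rw [auxPr_neg h1, auxPr_neg h2, hv, auxAdd_apply, auxPr_neg (fun h => h3 (Or.inl h)),
            auxPr_neg (fun h => h3 (Or.inr h))]
    rw [e]
    refine le_of_eq ((pow_left_inj₀ (norm_nonneg _) (norm_nonneg _) two_ne_zero).1 ?_)
    rw [hGn, hGn, auxT_sh F T hT, auxPr_h_sh, auxPr_h_sh, auxSh_norm, auxSh_norm]
  · intro x
    simp only [comp_apply, auxφ_self]
    have main : ∀ ε > 0, ‖P (G (auxPr auxq x))‖ ^ 2 +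
        (‖auxPr auxq (auxSh (0, 1) x)‖ ^ 2 - ‖auxPr auxq (T (auxSh (0, 1) x))‖ ^ 2) -
        (‖auxPr auxq x‖ ^ 2 - ‖auxPr auxq (T x)‖ ^ 2) ≤
        (‖P (G (auxPr auxq (auxSh (0, 1) x)))‖ + ε) ^ 2 := by
      intro ε hε
      obtain ⟨y, hy⟩ := hR2 (auxSh (0, 1) x) ε hε
      have hy2 := pow_le_pow_left₀ (norm_nonneg _) hy 2
      set y0 := auxPr auxn y with hy0
      set y' : AuxL U := auxSh (0, -1) y0 with hy'
      have hy'n : auxPr auxn y' = y' := by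
        refine aux_ext fun n => ?_
        by_cases h1 : n ∈ auxn
        · rw [auxPr_pos h1]
        · have h2 : n + (0, -1) ∉ auxn := by
            rintro ⟨h3, h4⟩
            apply h1
            simp at h3 h4
            exact ⟨h3, by omega⟩
          rw [auxPr_neg h1, hy', auxSh_apply, hy0, auxPr_neg h2]
      have hnorm : ‖y'‖ = ‖y0‖ := auxSh_norm _ _
      have hle := pow_le_pow_left₀ (norm_nonneg _) (hR1 x y') 2
      rw [hy'n] at hle
      have hy00 : auxPr auxn y0 = y0 := auxPr_idem _ _
      -- expansions
      have hexp : ∀ (z c : AuxL U), auxPr auxn c = c → ‖G (auxPr auxq z + c)‖ ^ 2 =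
          ‖auxPr auxq z‖ ^ 2 + ‖c‖ ^ 2 - ‖auxPr auxq (T z)‖ ^ 2
            - ‖auxPr auxn (T (auxPr auxq z + c))‖ ^ 2 := by
        intro z c hc
        have hcq : ∀ n ∈ auxq, c n = 0 := by
          intro n hn
          rw [← hc, auxPr_neg (Set.disjoint_left.1 aux_disj hn)]
        have e0 : ∀ n ∈ auxq, (auxPr auxq z + c) n = z n := by
          intro n hn
          rw [auxAdd_apply, auxPr_pos hn, hcq n hn, add_zero]
        have e1 : auxPr auxq (auxPr auxq z + c) = auxPr auxq z := auxPr_congr e0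
        have e2 : auxPr auxn (auxPr auxq z + c) = c := by
          rw [← hc]
          refine (auxPr_congr fun n hn => ?_).trans (auxPr_idem auxn c)
          rw [auxAdd_apply, auxPr_neg (Set.disjoint_right.1 aux_disj hn), zero_add]
        have e3 : auxPr auxq (T (auxPr auxq z + c)) = auxPr auxq (T z) :=
          auxT_caus F hF0 T hT _ auxq_up _ _ e0
        rw [hGn, auxPr_norm_add _ _ aux_disj, auxPr_norm_add _ _ aux_disj, e1, e2, e3]
        ring
      rw [hexp _ _ hy'n] at hle
      rw [hexp _ _ hy00] at hy2
      set v := auxPr auxq x + y' with hv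
      set v2 := auxPr auxq (auxSh (0, 1) x) + y0 with hv2
      have hag : ∀ n ∈ auxq ∪ auxn, v2 n = auxSh (0, 1) v n := by
        intro n hn
        have hyy : y' (n + (0, 1)) = y0 n := by
          have h0 : n + (0, 1) + (0, -1) = n := by ext <;> simp
          exact congrArg (fun k => (y0 k : U)) h0
        rw [auxSh_apply, hv, hv2, auxAdd_apply, auxAdd_apply, hyy]
        congr 1
        rcases hn with hn | hn
        · have h3 : n + (0, 1) ∈ auxq := auxq_up n hn _ (by simp) (by simp)
          rw [auxPr_pos hn, auxPr_pos h3, auxSh_apply]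
        · have h3 : n + (0, 1) ∉ auxq := by
            rintro ⟨h4, _⟩
            have := hn.1
            simp at h4
            omega
          rw [auxPr_neg (Set.disjoint_right.1 aux_disj hn), auxPr_neg h3]
      have hc := auxT_caus F hF0 T hT _ auxh_up _ _ hag
      have hc2 : auxPr auxn (T v2) = auxPr auxn (auxSh (0, 1) (auxPr auxn (T v))) := by
        refine auxPr_congr fun n hn => ?_
        have h5 : auxPr (auxq ∪ auxn) (T v2) n = T v2 n := auxPr_pos (Or.inr hn)
        have h6 : n + (0, 1) ∈ auxn := by
          obtain ⟨h7, h8⟩ := hn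
          constructor
          · simpa using h7
          · simp; omega
        rw [← h5, hc, auxPr_pos (Or.inr hn), auxT_sh F T hT, auxSh_apply, auxSh_apply, auxPr_pos h6]
      have hc3 : ‖auxPr auxn (T v2)‖ ≤ ‖auxPr auxn (T v)‖ := by
        rw [hc2]
        exact (auxPr_norm_le _ _).trans (auxSh_norm _ _).le
      have hc4 := pow_le_pow_left₀ (norm_nonneg _) hc3 2
      rw [hnorm] at hle
      linarith
    have hlim : Filter.Tendsto (fun ε : ℝ => (‖P (G (auxPr auxq (auxSh (0, 1) x)))‖ + ε) ^ 2)
        (nhdsWithin 0 (Set.Ioi 0))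
        (nhds ((‖P (G (auxPr auxq (auxSh (0, 1) x)))‖ + 0) ^ 2)) := by
      refine Filter.Tendsto.mono_left ?_ nhdsWithin_le_nhds
      exact (Continuous.tendsto (by fun_prop) 0)
    have := ge_of_tendsto hlim (by
      filter_upwards [self_mem_nhdsWithin] with ε hε using main ε hε)
    rw [add_zero] at this
    linarith

end agler


theorem aux_reidx {E : Type*} [AddCommMonoid E] [TopologicalSpace E] (g : ℤ × ℤ → E)
    (c : ℕ × ℕ → E) (m : ℤ × ℤ) (a : E) (h1 : ∀ k : ℕ × ℕ, g (m + ((k.1 : ℤ), (k.2 : ℤ))) = c k)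
    (h0 : ∀ n, ¬ (0 ≤ (n - m).1 ∧ 0 ≤ (n - m).2) → g n = 0) (hc : HasSum c a) : HasSum g a := by
  have hinj : Function.Injective (fun k : ℕ × ℕ => m + ((k.1 : ℤ), (k.2 : ℤ))) := by
    intro k l h
    have h2 := add_left_cancel h
    rw [Prod.mk.injEq] at h2
    exact Prod.ext (by exact_mod_cast h2.1) (by exact_mod_cast h2.2)
  refine (hinj.hasSum_iff ?_).1 ?_
  · intro n hn
    apply h0
    rintro ⟨h2, h3⟩
    apply hn
    refine ⟨((n - m).1.toNat, (n - m).2.toNat), ?_⟩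
    ext
    · simp only [Prod.fst_add, Prod.fst_sub] at h2 ⊢; omega
    · simp only [Prod.snd_add, Prod.snd_sub] at h3 ⊢; omega
  · have : (g ∘ fun k : ℕ × ℕ => m + ((k.1 : ℤ), (k.2 : ℤ))) = c := funext h1
    rw [this]; exact hc

theorem aux_geom2 (p q : ℂ) (hp : ‖p‖ < 1) (hq : ‖q‖ < 1) :
    HasSum (fun k : ℕ × ℕ => p ^ k.1 * q ^ k.2) ((1 - p)⁻¹ * (1 - q)⁻¹) := by
  have h1 := hasSum_geometric_of_norm_lt_one hp
  have h2 := hasSum_geometric_of_norm_lt_one hq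
  refine h1.mul h2 ?_
  exact summable_mul_of_summable_norm (summable_norm_geometric_of_norm_lt_one hp)
    (summable_norm_geometric_of_norm_lt_one hq)

section
variable {V : Type*} [NormedAddCommGroup V] [InnerProductSpace ℂ V]

/-- geometric family -/
def auxVf (w : ℂ × ℂ) (u : V) (n : ℤ × ℤ) : V :=
  if 0 ≤ n.1 ∧ 0 ≤ n.2 then (w.1 ^ n.1.toNat * w.2 ^ n.2.toNat) • u else 0

theorem auxVf_sum {w : ℂ × ℂ} (hw : w ∈ bidisk) (u : V) :
    Summable (fun n => ‖auxVf w u n‖ ^ 2) := by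
  have hb : ∀ p : ℂ, ‖p‖ < 1 → ‖((‖p‖ ^ 2 : ℝ) : ℂ)‖ < 1 := by
    intro p hp
    rw [Complex.norm_real, Real.norm_eq_abs, abs_of_nonneg (by positivity)]
    exact pow_lt_one₀ (norm_nonneg _) hp two_ne_zero
  have h := (aux_geom2 ((‖w.1‖ ^ 2 : ℝ) : ℂ) ((‖w.2‖ ^ 2 : ℝ) : ℂ) (hb _ hw.1) (hb _ hw.2))
  have h3 := (Complex.hasSum_re h).mul_right (‖u‖ ^ 2)
  refine (aux_reidx _ _ 0 _ (fun k => ?_) (fun n hn => ?_) h3).summable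
  · simp only [auxVf, zero_add]
    rw [if_pos ⟨Int.natCast_nonneg _, Int.natCast_nonneg _⟩, norm_smul, mul_pow]
    congr 1
    rw [← Complex.ofReal_pow, ← Complex.ofReal_pow, ← Complex.ofReal_mul, Complex.ofReal_re]
    simp only [Int.toNat_natCast, norm_mul, norm_pow]
    ring
  · rw [sub_zero] at hn
    rw [auxVf, if_neg hn]
    simp

open Classical in
/-- geometric vector -/
def auxV (w : ℂ × ℂ) (u : V) : AuxL V :=
  if h : Summable (fun n => ‖auxVf w u n‖ ^ 2) then auxMk (auxVf w u) h else 0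

theorem auxV_apply {w : ℂ × ℂ} (hw : w ∈ bidisk) (u : V) (n : ℤ × ℤ) :
    auxV w u n = auxVf w u n := by
  rw [auxV, dif_pos (auxVf_sum hw u)]
  rfl

theorem auxV_inner {w w' : ℂ × ℂ} (hw : w ∈ bidisk) (hw' : w' ∈ bidisk) (u u' : V) :
    (1 - (starRingEnd ℂ) w.1 * w'.1) * ((1 - (starRingEnd ℂ) w.2 * w'.2) *
      inner ℂ (auxV w u) (auxV w' u')) = inner ℂ u u' := by
  have hb : ∀ p q : ℂ, ‖p‖ < 1 → ‖q‖ < 1 → ‖(starRingEnd ℂ) p * q‖ < 1 := by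
    intro p q hp hq
    rw [norm_mul, RCLike.norm_conj]
    exact mul_lt_one_of_nonneg_of_lt_one_left (norm_nonneg _) hp hq.le
  have hn : ∀ p : ℂ, ‖p‖ < 1 → (1 - p) ≠ 0 := by
    intro p hp h
    rw [sub_eq_zero] at h
    rw [← h] at hp
    simp at hp
  have h1 := hb _ _ hw.1 hw'.1
  have h2 := hb _ _ hw.2 hw'.2
  have h := (aux_geom2 _ _ h1 h2).mul_right (inner ℂ u u')
  have h3 := lp.hasSum_inner (𝕜 := ℂ) (auxV w u) (auxV w' u')
  have h4 := aux_reidx (fun n => inner ℂ (auxV w u n) (auxV w' u' n)) _ 0 _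
    (fun k => ?_) (fun n hn => ?_) h
  · rw [h3.unique h4]
    have := hn _ h1
    have := hn _ h2
    field_simp
  · simp only [auxV_apply hw, auxV_apply hw', auxVf, zero_add]
    rw [if_pos ⟨Int.natCast_nonneg _, Int.natCast_nonneg _⟩,
      if_pos ⟨Int.natCast_nonneg _, Int.natCast_nonneg _⟩, inner_smul_left, inner_smul_right]
    simp only [Int.toNat_natCast, map_mul, map_pow]
    ring
  · rw [sub_zero] at hn
    simp only [auxV_apply hw, auxVf]
    rw [if_neg hn, inner_zero_left]

theorem auxV_sh1 {w : ℂ × ℂ} (hw : w ∈ bidisk) (u : V) :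
    auxPr auxq (auxSh (1, 0) (auxV w u)) = w.1 • auxV w u := by
  refine aux_ext fun n => ?_
  rw [auxSmul_apply, auxV_apply hw]
  by_cases h : n ∈ auxq
  · rw [auxPr_pos h, auxSh_apply, auxV_apply hw]
    obtain ⟨h1, h2⟩ := h
    simp only [auxVf, Prod.fst_add, Prod.snd_add]
    rw [if_pos ⟨by omega, by omega⟩, if_pos ⟨h1, h2⟩, smul_smul, add_zero,
      Int.toNat_add h1 (by norm_num)]
    congr 1
    simp [pow_succ]; ring
  · rw [auxPr_neg h]
    have h' : ¬ (0 ≤ n.1 ∧ 0 ≤ n.2) := h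
    rw [auxVf, if_neg h', smul_zero]

theorem auxV_sh2 {w : ℂ × ℂ} (hw : w ∈ bidisk) (u : V) :
    auxPr auxq (auxSh (0, 1) (auxV w u)) = w.2 • auxV w u := by
  refine aux_ext fun n => ?_
  rw [auxSmul_apply, auxV_apply hw]
  by_cases h : n ∈ auxq
  · rw [auxPr_pos h, auxSh_apply, auxV_apply hw]
    obtain ⟨h1, h2⟩ := h
    simp only [auxVf, Prod.fst_add, Prod.snd_add]
    rw [if_pos ⟨by omega, by omega⟩, if_pos ⟨h1, h2⟩, smul_smul, add_zero,
      Int.toNat_add h2 (by norm_num)]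
    congr 1
    simp [pow_succ]; ring
  · rw [auxPr_neg h]
    have h' : ¬ (0 ≤ n.1 ∧ 0 ≤ n.2) := h
    rw [auxVf, if_neg h', smul_zero]

theorem auxV_pr {w : ℂ × ℂ} (hw : w ∈ bidisk) (u : V) :
    auxPr auxq (auxV w u) = auxV w u := by
  refine aux_ext fun n => ?_
  by_cases h : n ∈ auxq
  · rw [auxPr_pos h]
  · rw [auxPr_neg h, auxV_apply hw]
    have h' : ¬ (0 ≤ n.1 ∧ 0 ≤ n.2) := h
    rw [auxVf, if_neg h']

end

section
variable {U Y : Type*} [NormedAddCommGroup U] [InnerProductSpace ℂ U] [CompleteSpace U]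
  [NormedAddCommGroup Y] [InnerProductSpace ℂ Y] [CompleteSpace Y]

theorem auxF_zero (a : ℕ × ℕ → (U →L[ℂ] Y)) (k : ℤ × ℤ) (h : ¬ (0 ≤ k.1 ∧ 0 ≤ k.2)) :
    auxF a k = 0 := by
  rw [auxF, if_neg h]

theorem aux_hs_apply {b : ℕ × ℕ → (U →L[ℂ] Y)} {c : U →L[ℂ] Y} (hs : HasSum b c) (u : U) :
    HasSum (fun k => b k u) (c u) :=
  ContinuousLinearMap.hasSum (φ := (ContinuousLinearMap.apply ℂ Y u : (U →L[ℂ] Y) →L[ℂ] Y)) hs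

theorem auxT_V (a : ℕ × ℕ → (U →L[ℂ] Y)) (T : AuxL U →L[ℂ] AuxL Y)
    (hT : ∀ x m, HasSum (fun n => auxF a (n - m) (x n)) (T x m)) {w : ℂ × ℂ} (hw : w ∈ bidisk)
    (fw : U →L[ℂ] Y) (hs : HasSum (fun k : ℕ × ℕ => (w.1 ^ k.1 * w.2 ^ k.2) • a k) fw) (u : U) :
    auxPr auxq (T (auxV w u)) = auxV w (fw u) := by
  refine aux_ext fun m => ?_
  rw [auxV_apply hw]
  by_cases h : m ∈ auxq
  · rw [auxPr_pos h]
    obtain ⟨h1, h2⟩ := h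
    refine HasSum.unique (hT _ m) ?_
    rw [auxVf, if_pos ⟨h1, h2⟩]
    have hs1 : HasSum (fun k : ℕ × ℕ => ((w.1 ^ k.1 * w.2 ^ k.2) • a k) u) (fw u) :=
      aux_hs_apply hs u
    have hs2 := hs1.const_smul (w.1 ^ m.1.toNat * w.2 ^ m.2.toNat)
    refine aux_reidx _ _ m _ (fun k => ?_) (fun n hn => ?_) hs2
    · rw [add_sub_cancel_left, auxV_apply hw, auxF, auxVf,
        if_pos ⟨Int.natCast_nonneg _, Int.natCast_nonneg _⟩]
      simp only [Prod.fst_add, Prod.snd_add]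
      rw [if_pos ⟨by omega, by omega⟩, map_smul, smul_apply, smul_smul,
        Int.toNat_add h1 (Int.natCast_nonneg _), Int.toNat_add h2 (Int.natCast_nonneg _)]
      simp only [Int.toNat_natCast]
      congr 1
      ring
    · rw [auxF_zero a _ hn]; rfl
  · rw [auxPr_neg h]
    have h' : ¬ (0 ≤ m.1 ∧ 0 ≤ m.2) := h
    rw [auxVf, if_neg h']

theorem aux_agler (f : ℂ × ℂ → (U →L[ℂ] Y)) (hf : AnalyticOnNhd ℂ f bidisk)
    (hb : ∀ w ∈ bidisk, ‖f w‖ ≤ 1) :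
    ∃ g1 g2 : ℂ × ℂ → U → AuxL U, ∀ w ∈ bidisk, ∀ w' ∈ bidisk, ∀ u u' : U,
      (1 - (starRingEnd ℂ) w.1 * w'.1) * inner ℂ (g1 w u) (g1 w' u') +
      (1 - (starRingEnd ℂ) w.2 * w'.2) * inner ℂ (g2 w u) (g2 w' u') =
      inner ℂ u u' - inner ℂ (f w u) (f w' u') := by
  obtain ⟨a, ha, hs⟩ := aux_coef f hf hb
  obtain ⟨T, hT1, hT⟩ := aux_exists_T (auxF a) (fun x S M => aux_contr f hb a ha hs x S M)
  obtain ⟨R, hR0, hR1, hR2⟩ := aux_key (auxF a) (auxF_zero a) T hT1 hT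
  have hre : ∀ x : AuxL U, (inner ℂ x x : ℂ).re = ‖x‖ ^ 2 :=
    fun x => (norm_sq_eq_re_inner (𝕜 := ℂ) x).symm
  obtain ⟨D1, hD1⟩ := aux_sqrt_form
    ((ContinuousLinearMap.adjoint R) ∘L R -
      (ContinuousLinearMap.adjoint (R ∘L auxSh (1, 0))) ∘L (R ∘L auxSh (1, 0)))
    (fun x y => inner ℂ (R x) (R y) - inner ℂ (R (auxSh (1, 0) x)) (R (auxSh (1, 0) y)))
    (fun x y => by
      simp only [sub_apply, comp_apply, inner_sub_right, ContinuousLinearMap.adjoint_inner_right])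
    (fun x y => by simp only [map_sub, inner_conj_symm])
    (fun x => by
      rw [Complex.sub_re, hre, hre]
      have := pow_le_pow_left₀ (norm_nonneg _) (hR1 x) 2
      linarith)
  obtain ⟨D2, hD2⟩ := aux_sqrt_form
    ((auxD T auxq - (ContinuousLinearMap.adjoint R) ∘L R) -
      (ContinuousLinearMap.adjoint (auxSh (0, 1))) ∘L
        (auxD T auxq - (ContinuousLinearMap.adjoint R) ∘L R) ∘L auxSh (0, 1))
    (fun x y => (auxφ T auxq x y - inner ℂ (R x) (R y)) -
      (auxφ T auxq (auxSh (0, 1) x) (auxSh (0, 1) y) -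
        inner ℂ (R (auxSh (0, 1) x)) (R (auxSh (0, 1) y))))
    (fun x y => by
      simp only [sub_apply, comp_apply, inner_sub_right, ContinuousLinearMap.adjoint_inner_right,
        auxD_inner])
    (fun x y => by simp only [map_sub, inner_conj_symm, auxφ_symm])
    (fun x => by
      rw [Complex.sub_re, Complex.sub_re, Complex.sub_re, hre, hre]
      have := hR2 x
      linarith)
  refine ⟨fun w u => D2 (auxV w u), fun w u => D1 (auxV w u), ?_⟩
  intro w hw w' hw' u u'
  have hφq : ∀ x y, auxφ T auxq x y = auxφ T auxq (auxPr auxq x) (auxPr auxq y) := by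
    intro x y
    have h : ∀ z, auxPr auxq (T z) = auxPr auxq (T (auxPr auxq z)) := fun z =>
      auxT_caus (auxF a) (auxF_zero a) T hT _ auxq_up _ _ (fun n hn => (auxPr_pos hn).symm)
    rw [auxφ, auxφ, auxPr_idem, auxPr_idem, ← h, ← h]
  have hr1 : ∀ (w : ℂ × ℂ), w ∈ bidisk → ∀ u : U,
      R (auxSh (1, 0) (auxV w u)) = w.1 • R (auxV w u) := by
    intro w hw u
    rw [← hR0, auxV_sh1 hw, map_smul]
  have hr2 : ∀ (w : ℂ × ℂ), w ∈ bidisk → ∀ u : U,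
      R (auxSh (0, 1) (auxV w u)) = w.2 • R (auxV w u) := by
    intro w hw u
    rw [← hR0, auxV_sh2 hw, map_smul]
  have hφ2 : auxφ T auxq (auxSh (0, 1) (auxV w u)) (auxSh (0, 1) (auxV w' u')) =
      (starRingEnd ℂ) w.2 * w'.2 * auxφ T auxq (auxV w u) (auxV w' u') := by
    rw [hφq, auxV_sh2 hw, auxV_sh2 hw']
    simp only [auxφ, map_smul, inner_smul_left, inner_smul_right]
    ring
  have hφ : auxφ T auxq (auxV w u) (auxV w' u') =
      inner ℂ (auxV w u) (auxV w' u') - inner ℂ (auxV w (f w u)) (auxV w' (f w' u')) := by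
    rw [auxφ, auxV_pr hw, auxV_pr hw', auxT_V a T hT hw (f w) (hs w hw),
      auxT_V a T hT hw' (f w') (hs w' hw')]
  have i1 := auxV_inner hw hw' u u'
  have i2 := auxV_inner hw hw' (f w u) (f w' u')
  simp only [hD1, hD2, hr1 w hw, hr1 w' hw', hr2 w hw, hr2 w' hw', hφ2, hφ, inner_smul_left,
    inner_smul_right]
  rw [← i1, ← i2]
  ring
end


universe u v

variable {H : Type*} {U : Type u} {Y : Type v}
  [NormedAddCommGroup H] [InnerProductSpace ℂ H] [CompleteSpace H]
  [NormedAddCommGroup U] [InnerProductSpace ℂ U] [CompleteSpace U]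
  [NormedAddCommGroup Y] [InnerProductSpace ℂ Y] [CompleteSpace Y]

/-- The block operator `[[A₁, A₂], [A₂, A₁]]` acting on `H ⊕ H`. -/
def symBlock (A₁ A₂ : H →L[ℂ] H) : (H × H) →L[ℂ] (H × H) :=
  (A₁.coprod A₂).prod (A₂.coprod A₁)

/-- The block diagonal operator `diag(z I_H, ζ I_H)` acting on `H ⊕ H`. -/
def diagOp (z ζ : ℂ) : (H × H) →L[ℂ] (H × H) :=
  (z • ContinuousLinearMap.id ℂ H).prodMap (ζ • ContinuousLinearMap.id ℂ H)

/-- The colligation `M = [[A₁,A₂,B],[A₂,A₁,B],[C,C,D]] : H ⊕ H ⊕ U → H ⊕ H ⊕ Y` is a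
contraction (with respect to the Hilbert space direct sum norms). -/
def SymColligationContractive (A₁ A₂ : H →L[ℂ] H) (B : U →L[ℂ] H) (C : H →L[ℂ] Y)
    (D : U →L[ℂ] Y) : Prop :=
  ∀ (h₁ h₂ : H) (u : U),
    ‖A₁ h₁ + A₂ h₂ + B u‖ ^ 2 + ‖A₂ h₁ + A₁ h₂ + B u‖ ^ 2 + ‖C h₁ + C h₂ + D u‖ ^ 2 ≤
      ‖h₁‖ ^ 2 + ‖h₂‖ ^ 2 + ‖u‖ ^ 2

/-- The transfer function
`D + [C C] ⬝ diag(zI,ζI) ⬝ (I - [[A₁,A₂],[A₂,A₁]] ⬝ diag(zI,ζI))⁻¹ ⬝ [B;B]`. -/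
def symTransfer (A₁ A₂ : H →L[ℂ] H) (B : U →L[ℂ] H) (C : H →L[ℂ] Y) (D : U →L[ℂ] Y)
    (z ζ : ℂ) : U →L[ℂ] Y :=
  D + (C.coprod C) ∘L diagOp z ζ ∘L
    Ring.inverse (1 - symBlock A₁ A₂ * diagOp z ζ) ∘L (B.prod B)


section back

theorem aux_res {R : Type*} [NormedRing R] [NormedAlgebra ℂ R] [CompleteSpace R] (S P Q : R)
    (w : ℂ × ℂ) (hu : IsUnit (1 - S * (w.1 • P + w.2 • Q))) :
    AnalyticAt ℂ (fun w : ℂ × ℂ => (w.1 • P + w.2 • Q) *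
      Ring.inverse (1 - S * (w.1 • P + w.2 • Q))) w := by
  have hd : AnalyticAt ℂ (fun w : ℂ × ℂ => w.1 • P + w.2 • Q) w :=
    (analyticAt_fst.smul analyticAt_const).add (analyticAt_snd.smul analyticAt_const)
  have h1 : AnalyticAt ℂ (fun w : ℂ × ℂ => 1 - S * (w.1 • P + w.2 • Q)) w :=
    analyticAt_const.sub (analyticAt_const.mul hd)
  have h3 : AnalyticAt ℂ (fun w : ℂ × ℂ => Ring.inverse (1 - S * (w.1 • P + w.2 • Q))) w := by
    obtain ⟨v, hv⟩ := hu
    have h2 := analyticAt_inverse (𝕜 := ℂ) v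
    rw [hv] at h2
    exact AnalyticAt.fun_comp h2 h1
  exact hd.mul h3

theorem aux_solve (A₁ A₂ : H →L[ℂ] H) (B : U →L[ℂ] H) (C : H →L[ℂ] Y) (D : U →L[ℂ] Y)
    (z ζ : ℂ) (hu : IsUnit (1 - symBlock A₁ A₂ * diagOp z ζ)) (u : U) :
    ∃ x₁ x₂ : H, x₁ = A₁ (z • x₁) + A₂ (ζ • x₂) + B u ∧ x₂ = A₂ (z • x₁) + A₁ (ζ • x₂) + B u ∧
      symTransfer A₁ A₂ B C D z ζ u = C (z • x₁) + C (ζ • x₂) + D u := by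
  set x : H × H := (Ring.inverse (1 - symBlock A₁ A₂ * diagOp z ζ : (H × H) →L[ℂ] (H × H)) : (H × H) →L[ℂ] (H × H)) (B u, B u) with hx
  have h := congrArg (fun S : (H × H) →L[ℂ] (H × H) => S (B u, B u)) (Ring.mul_inverse_cancel _ hu)
  have h' : x - symBlock A₁ A₂ (diagOp z ζ x) = (B u, B u) := h
  refine ⟨x.1, x.2, ?_, ?_, ?_⟩
  · have h1 := congrArg Prod.fst h'
    have h2 : x.1 - (A₁ (z • x.1) + A₂ (ζ • x.2)) = B u := h1
    rw [← h2]; abel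
  · have h1 := congrArg Prod.snd h'
    have h2 : x.2 - (A₂ (z • x.1) + A₁ (ζ • x.2)) = B u := h1
    rw [← h2]; abel
  · have h3 : symTransfer A₁ A₂ B C D z ζ u = D u + (C (z • x.1) + C (ζ • x.2)) := rfl
    rw [h3, add_comm]

theorem aux_transfer (A₁ A₂ : H →L[ℂ] H) (B : U →L[ℂ] H) (C : H →L[ℂ] Y) (D : U →L[ℂ] Y)
    (z ζ : ℂ) (hu : IsUnit (1 - symBlock A₁ A₂ * diagOp z ζ)) (u : U) (x₁ x₂ : H)
    (h1 : x₁ = A₁ (z • x₁) + A₂ (ζ • x₂) + B u) (h2 : x₂ = A₂ (z • x₁) + A₁ (ζ • x₂) + B u) :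
    symTransfer A₁ A₂ B C D z ζ u = C (z • x₁) + C (ζ • x₂) + D u := by
  have h : (1 - symBlock A₁ A₂ * diagOp z ζ : (H × H) →L[ℂ] (H × H)) (x₁, x₂) = (B u, B u) := by
    have e : (1 - symBlock A₁ A₂ * diagOp z ζ : (H × H) →L[ℂ] (H × H)) (x₁, x₂) =
      (x₁ - (A₁ (z • x₁) + A₂ (ζ • x₂)), x₂ - (A₂ (z • x₁) + A₁ (ζ • x₂))) := rfl
    rw [e]
    ext
    · change x₁ - (A₁ (z • x₁) + A₂ (ζ • x₂)) = B u
      rw [sub_eq_iff_eq_add, add_comm (B u)]; exact h1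
    · change x₂ - (A₂ (z • x₁) + A₁ (ζ • x₂)) = B u
      rw [sub_eq_iff_eq_add, add_comm (B u)]; exact h2
  have h' := congrArg (fun S : (H × H) →L[ℂ] (H × H) => S (x₁, x₂)) (Ring.inverse_mul_cancel _ hu)
  have h'' : (Ring.inverse (1 - symBlock A₁ A₂ * diagOp z ζ : (H × H) →L[ℂ] (H × H)) : (H × H) →L[ℂ] (H × H))
    ((1 - symBlock A₁ A₂ * diagOp z ζ : (H × H) →L[ℂ] (H × H)) (x₁, x₂)) = (x₁, x₂) := h'
  rw [h] at h''
  have h3 : symTransfer A₁ A₂ B C D z ζ u = D u + (C.coprod C) (diagOp z ζ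
    ((Ring.inverse (1 - symBlock A₁ A₂ * diagOp z ζ : (H × H) →L[ℂ] (H × H)) : (H × H) →L[ℂ] (H × H)) (B u, B u))) := rfl
  rw [h3, h'', add_comm]
  rfl

theorem aux_transfer_norm (A₁ A₂ : H →L[ℂ] H) (B : U →L[ℂ] H) (C : H →L[ℂ] Y) (D : U →L[ℂ] Y)
    (hc : SymColligationContractive A₁ A₂ B C D) (w : ℂ × ℂ) (hw : w ∈ bidisk)
    (hu : IsUnit (1 - symBlock A₁ A₂ * diagOp w.1 w.2)) :
    ‖symTransfer A₁ A₂ B C D w.1 w.2‖ ≤ 1 := by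
  refine ContinuousLinearMap.opNorm_le_bound _ zero_le_one fun u => ?_
  obtain ⟨x₁, x₂, h1, h2, h3⟩ := aux_solve A₁ A₂ B C D w.1 w.2 hu u
  have h := hc (w.1 • x₁) (w.2 • x₂) u
  rw [← h1, ← h2, ← h3] at h
  have hs : ∀ (c : ℂ) (x : H), ‖c‖ < 1 → ‖c • x‖ ^ 2 ≤ ‖x‖ ^ 2 := by
    intro c x hcc
    refine pow_le_pow_left₀ (norm_nonneg _) ?_ 2
    rw [norm_smul]
    exact mul_le_of_le_one_left (norm_nonneg _) hcc.le
  have h4 := hs w.1 x₁ hw.1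
  have h5 := hs w.2 x₂ hw.2
  rw [one_mul]
  refine (pow_le_pow_iff_left₀ (norm_nonneg _) (norm_nonneg _) two_ne_zero).1 ?_
  linarith

theorem aux_transfer_symm (A₁ A₂ : H →L[ℂ] H) (B : U →L[ℂ] H) (C : H →L[ℂ] Y) (D : U →L[ℂ] Y)
    (z ζ : ℂ) (hu : IsUnit (1 - symBlock A₁ A₂ * diagOp z ζ))
    (hu' : IsUnit (1 - symBlock A₁ A₂ * diagOp ζ z)) :
    symTransfer A₁ A₂ B C D ζ z = symTransfer A₁ A₂ B C D z ζ := by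
  ext u
  obtain ⟨x₁, x₂, h1, h2, h3⟩ := aux_solve A₁ A₂ B C D z ζ hu u
  rw [h3, aux_transfer A₁ A₂ B C D ζ z hu' u x₂ x₁ (by rw [add_comm (A₁ _)]; exact h2)
    (by rw [add_comm (A₂ _)]; exact h1), add_comm (C _)]

theorem aux_transfer_analytic (A₁ A₂ : H →L[ℂ] H) (B : U →L[ℂ] H) (C : H →L[ℂ] Y) (D : U →L[ℂ] Y)
    (w : ℂ × ℂ) (hu : IsUnit (1 - symBlock A₁ A₂ * diagOp w.1 w.2)) :
    AnalyticAt ℂ (fun w : ℂ × ℂ => symTransfer A₁ A₂ B C D w.1 w.2) w := by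
  have e : ∀ w : ℂ × ℂ, (diagOp w.1 w.2 : (H × H) →L[ℂ] (H × H)) =
        w.1 • (diagOp 1 0 : (H × H) →L[ℂ] (H × H)) +
          w.2 • (diagOp 0 1 : (H × H) →L[ℂ] (H × H)) := by
    intro w
    ext x <;> simp [diagOp]
  rw [e] at hu
  have hm := aux_res (R := (H × H) →L[ℂ] (H × H)) (symBlock A₁ A₂) (diagOp 1 0) (diagOp 0 1) w hu
  let Γ : ((H × H) →L[ℂ] (H × H)) →L[ℂ] (U →L[ℂ] Y) :=
    (ContinuousLinearMap.compL ℂ U (H × H) Y (C.coprod C)) ∘L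
      ((ContinuousLinearMap.compL ℂ U (H × H) (H × H)).flip (B.prod B))
  have hΓ := (Γ.analyticAt _).comp hm
  have hs := (analyticAt_const (𝕜 := ℂ) (v := D) (x := w)).add hΓ
  refine hs.congr (Filter.Eventually.of_forall fun w' => ?_)
  change _ = symTransfer A₁ A₂ B C D w'.1 w'.2
  rw [symTransfer, e w']
  rfl

theorem aux_isUnit (A₁ A₂ : H →L[ℂ] H)
    (hc : ∀ h₁ h₂, ‖A₁ h₁ + A₂ h₂‖ ^ 2 + ‖A₂ h₁ + A₁ h₂‖ ^ 2 ≤ ‖h₁‖ ^ 2 + ‖h₂‖ ^ 2)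
    (w : ℂ × ℂ) (hw : w ∈ bidisk) : IsUnit (1 - symBlock A₁ A₂ * diagOp w.1 w.2) := by
  let e : WithLp 2 (H × H) ≃L[ℂ] H × H := WithLp.prodContinuousLinearEquiv 2 ℂ H H
  let T : (H × H) →L[ℂ] (H × H) := symBlock A₁ A₂ * diagOp w.1 w.2
  let T' : WithLp 2 (H × H) →L[ℂ] WithLp 2 (H × H) := (e.symm : _ →L[ℂ] _) ∘L T ∘L (e : _ →L[ℂ] _)
  have hT' : ‖T'‖ < 1 := by
    set r := max ‖w.1‖ ‖w.2‖ with hr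
    have hr1 : r < 1 := max_lt hw.1 hw.2
    have hr0 : 0 ≤ r := le_max_of_le_left (norm_nonneg _)
    refine lt_of_le_of_lt (ContinuousLinearMap.opNorm_le_bound _ hr0 fun x => ?_) hr1
    refine (pow_le_pow_iff_left₀ (norm_nonneg _) (by positivity) two_ne_zero).1 ?_
    rw [mul_pow, WithLp.prod_norm_sq_eq_of_L2, WithLp.prod_norm_sq_eq_of_L2 x]
    have h := hc (w.1 • x.fst) (w.2 • x.snd)
    have e1 : (T' x).fst = A₁ (w.1 • x.fst) + A₂ (w.2 • x.snd) := rfl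
    have e2 : (T' x).snd = A₂ (w.1 • x.fst) + A₁ (w.2 • x.snd) := rfl
    rw [e1, e2]
    refine h.trans ?_
    rw [norm_smul, norm_smul, mul_pow, mul_pow, mul_add]
    gcongr
    · exact le_max_left _ _
    · exact le_max_right _ _
  have hu := isUnit_one_sub_of_norm_lt_one hT'
  obtain ⟨S, hS1, hS2⟩ := isUnit_iff_exists.1 hu
  refine isUnit_iff_exists.2 ⟨(e : _ →L[ℂ] _) ∘L S ∘L (e.symm : _ →L[ℂ] _), ?_, ?_⟩
  · refine ContinuousLinearMap.ext fun x => ?_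
    have h1 := congrArg (fun S => e (S (e.symm x))) hS1
    have h2 : e (S (e.symm x) - e.symm (T (e (S (e.symm x))))) = e (e.symm x) := h1
    rw [map_sub, e.apply_symm_apply, e.apply_symm_apply] at h2
    exact h2
  · refine ContinuousLinearMap.ext fun x => ?_
    have h1 := congrArg (fun S => e (S (e.symm x))) hS2
    have h2 : e (S (e.symm x - e.symm (T (e (e.symm x))))) = e (e.symm x) := h1
    rw [e.apply_symm_apply, ← map_sub] at h2
    exact h2

end back

section forw

theorem aux_lurk3 {J : Type*} (a1 a2 : J → H) (a3 : J → U) (b1 b2 : J → H) (b3 : J → Y)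
    (h : ∀ i j, inner ℂ (a1 i) (a1 j) + inner ℂ (a2 i) (a2 j) + inner ℂ (a3 i) (a3 j) =
      inner ℂ (b1 i) (b1 j) + inner ℂ (b2 i) (b2 j) + inner ℂ (b3 i) (b3 j)) :
    ∃ N : ((H × H) × U) →L[ℂ] ((H × H) × Y),
      (∀ x, ‖(N x).1.1‖ ^ 2 + ‖(N x).1.2‖ ^ 2 + ‖(N x).2‖ ^ 2 ≤
        ‖x.1.1‖ ^ 2 + ‖x.1.2‖ ^ 2 + ‖x.2‖ ^ 2) ∧
      ∀ j, N ((a1 j, a2 j), a3 j) = ((b1 j, b2 j), b3 j) := by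
  let e : WithLp 2 (H × H) ≃L[ℂ] H × H := WithLp.prodContinuousLinearEquiv 2 ℂ H H
  let eU : WithLp 2 (WithLp 2 (H × H) × U) ≃L[ℂ] (H × H) × U :=
    (WithLp.prodContinuousLinearEquiv 2 ℂ (WithLp 2 (H × H)) U).trans
      (e.prodCongr (ContinuousLinearEquiv.refl ℂ U))
  let eY : WithLp 2 (WithLp 2 (H × H) × Y) ≃L[ℂ] (H × H) × Y :=
    (WithLp.prodContinuousLinearEquiv 2 ℂ (WithLp 2 (H × H)) Y).trans
      (e.prodCongr (ContinuousLinearEquiv.refl ℂ Y))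
  have nU : ∀ x, ‖x‖ ^ 2 = ‖(eU x).1.1‖ ^ 2 + ‖(eU x).1.2‖ ^ 2 + ‖(eU x).2‖ ^ 2 := by
    intro x
    rw [WithLp.prod_norm_sq_eq_of_L2, WithLp.prod_norm_sq_eq_of_L2 x.fst]
    rfl
  have nY : ∀ x, ‖x‖ ^ 2 = ‖(eY x).1.1‖ ^ 2 + ‖(eY x).1.2‖ ^ 2 + ‖(eY x).2‖ ^ 2 := by
    intro x
    rw [WithLp.prod_norm_sq_eq_of_L2, WithLp.prod_norm_sq_eq_of_L2 x.fst]
    rfl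
  obtain ⟨M, hM1, hM2⟩ := aux_lurk (fun j => eU.symm ((a1 j, a2 j), a3 j))
    (fun j => eY.symm ((b1 j, b2 j), b3 j)) (fun i j => by
      rw [WithLp.prod_inner_apply, WithLp.prod_inner_apply, WithLp.prod_inner_apply,
        WithLp.prod_inner_apply]
      exact h i j)
  refine ⟨(eY : _ →L[ℂ] _) ∘L M ∘L (eU.symm : _ →L[ℂ] _), fun x => ?_, fun j => ?_⟩
  · have h1 := pow_le_pow_left₀ (norm_nonneg _) (hM1 (eU.symm x)) 2
    rw [nU, nY, eU.apply_symm_apply] at h1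
    exact h1
  · change eY (M (eU.symm _)) = _
    rw [hM2 j, eY.apply_symm_apply]

end forw

theorem aux_swap_mem {w : ℂ × ℂ} (hw : w ∈ bidisk) : (w.2, w.1) ∈ bidisk := ⟨hw.2, hw.1⟩

theorem aux_symker (f : ℂ × ℂ → (U →L[ℂ] Y)) (hf : AnalyticOnNhd ℂ f bidisk)
    (hb : ∀ w ∈ bidisk, ‖f w‖ ≤ 1) (hsym : ∀ w ∈ bidisk, f (w.2, w.1) = f w) :
    ∃ (H : Type (max u v)) (_ : NormedAddCommGroup H) (_ : InnerProductSpace ℂ H)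
      (_ : CompleteSpace H) (g : ℂ × ℂ → U → H), ∀ w ∈ bidisk, ∀ w' ∈ bidisk, ∀ u u' : U,
      (1 - (starRingEnd ℂ) w.1 * w'.1) * inner ℂ (g w u) (g w' u') +
      (1 - (starRingEnd ℂ) w.2 * w'.2) * inner ℂ (g (w.2, w.1) u) (g (w'.2, w'.1) u') =
      inner ℂ u u' - inner ℂ (f w u) (f w' u') := by
  obtain ⟨g1, g2, hg⟩ := aux_agler f hf hb
  let c : ℂ := (((Real.sqrt 2)⁻¹ : ℝ) : ℂ)
  have hc : (starRingEnd ℂ) c * c = 1 / 2 := by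
    rw [Complex.conj_ofReal, ← Complex.ofReal_mul, ← mul_inv, Real.mul_self_sqrt (by norm_num)]
    norm_num
  let g : ℂ × ℂ → U → WithLp 2 (WithLp 2 (AuxL U × AuxL U) × Y) := fun w u =>
    c • WithLp.toLp 2 (WithLp.toLp 2 (g1 w u, g2 (w.2, w.1) u), 0)
  have hgi : ∀ w w' u u', inner ℂ (g w u) (g w' u') = 1 / 2 * (inner ℂ (g1 w u) (g1 w' u') +
      inner ℂ (g2 (w.2, w.1) u) (g2 (w'.2, w'.1) u')) := by
    intro w w' u u'
    simp only [g]
    rw [inner_smul_left, inner_smul_right, ← mul_assoc, hc, WithLp.prod_inner_apply,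
      WithLp.prod_inner_apply]
    simp
  refine ⟨WithLp 2 (WithLp 2 (AuxL U × AuxL U) × Y), inferInstance, inferInstance, inferInstance,
    g, ?_⟩
  intro w hw w' hw' u u'
  have h1 := hg w hw w' hw' u u'
  have h2 := hg _ (aux_swap_mem hw) _ (aux_swap_mem hw') u u'
  rw [hsym w hw, hsym w' hw'] at h2
  simp only [hgi]
  simp only at h2
  linear_combination (1 / 2) * h1 + (1 / 2) * h2

theorem aux_half {E : Type*} [NormedAddCommGroup E] [InnerProductSpace ℂ E] (a b : E) :
    ‖(1 / 2 : ℂ) • (a + b)‖ ^ 2 ≤ (‖a‖ ^ 2 + ‖b‖ ^ 2) / 2 := by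
  rw [norm_smul, mul_pow]
  have h := pow_le_pow_left₀ (norm_nonneg _) (norm_add_le a b) 2
  have h2 : ‖(1 / 2 : ℂ)‖ ^ 2 = 1 / 4 := by norm_num
  rw [h2]
  nlinarith [sq_nonneg (‖a‖ - ‖b‖)]

theorem aux_hh {E : Type*} [NormedAddCommGroup E] [InnerProductSpace ℂ E] (x : E) :
    x = (1 / 2 : ℂ) • (x + x) := by
  module

theorem aux_realize (f : ℂ × ℂ → (U →L[ℂ] Y)) (hsym : ∀ w ∈ bidisk, f (w.2, w.1) = f w)
    (g : ℂ × ℂ → U → H) (hg : ∀ w ∈ bidisk, ∀ w' ∈ bidisk, ∀ u u' : U,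
      (1 - (starRingEnd ℂ) w.1 * w'.1) * inner ℂ (g w u) (g w' u') +
      (1 - (starRingEnd ℂ) w.2 * w'.2) * inner ℂ (g (w.2, w.1) u) (g (w'.2, w'.1) u') =
      inner ℂ u u' - inner ℂ (f w u) (f w' u')) :
    ∃ (A₁ A₂ : H →L[ℂ] H) (B : U →L[ℂ] H) (C : H →L[ℂ] Y)
        (D : U →L[ℂ] Y),
        SymColligationContractive A₁ A₂ B C D ∧
          ∀ w ∈ bidisk,
            IsUnit (1 - symBlock A₁ A₂ * diagOp w.1 w.2) ∧
              f w = symTransfer A₁ A₂ B C D w.1 w.2 := by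
  obtain ⟨N, hN1, hN2⟩ := aux_lurk3 (J := bidisk × U)
    (fun j => j.1.1.1 • g j.1.1 j.2) (fun j => j.1.1.2 • g (j.1.1.2, j.1.1.1) j.2) (fun j => j.2)
    (fun j => g j.1.1 j.2) (fun j => g (j.1.1.2, j.1.1.1) j.2) (fun j => f j.1.1 j.2)
    (by
      rintro ⟨⟨w, hw⟩, u⟩ ⟨⟨w', hw'⟩, u'⟩
      have h := hg w hw w' hw' u u'
      simp only [inner_smul_left, inner_smul_right]
      linear_combination -h)
  let i1 : H →L[ℂ] (H × H) × U := (inl ℂ (H × H) U) ∘L (inl ℂ H H)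
  let i2 : H →L[ℂ] (H × H) × U := (inl ℂ (H × H) U) ∘L (inr ℂ H H)
  let i3 : U →L[ℂ] (H × H) × U := inr ℂ (H × H) U
  let p1 : (H × H) × Y →L[ℂ] H := (fst ℂ H H) ∘L (fst ℂ (H × H) Y)
  let p2 : (H × H) × Y →L[ℂ] H := (snd ℂ H H) ∘L (fst ℂ (H × H) Y)
  let p3 : (H × H) × Y →L[ℂ] Y := snd ℂ (H × H) Y
  have hdec : ∀ h₁ h₂ u, ((h₁, h₂), u) = i1 h₁ + i2 h₂ + i3 u := by
    intro h₁ h₂ u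
    simp [i1, i2, i3]
  let A₁ : H →L[ℂ] H := (1 / 2 : ℂ) • (p1 ∘L N ∘L i1 + p2 ∘L N ∘L i2)
  let A₂ : H →L[ℂ] H := (1 / 2 : ℂ) • (p1 ∘L N ∘L i2 + p2 ∘L N ∘L i1)
  let B : U →L[ℂ] H := (1 / 2 : ℂ) • (p1 ∘L N ∘L i3 + p2 ∘L N ∘L i3)
  let C : H →L[ℂ] Y := (1 / 2 : ℂ) • (p3 ∘L N ∘L i1 + p3 ∘L N ∘L i2)
  let D : U →L[ℂ] Y := p3 ∘L N ∘L i3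
  have k1 : ∀ h₁ h₂ u, A₁ h₁ + A₂ h₂ + B u =
      (1 / 2 : ℂ) • ((N ((h₁, h₂), u)).1.1 + (N ((h₂, h₁), u)).1.2) := by
    intro h₁ h₂ u
    change _ = (1 / 2 : ℂ) • (p1 (N _) + p2 (N _))
    rw [hdec, hdec]
    simp only [A₁, A₂, B, smul_apply, add_apply, comp_apply, map_add]
    module
  have k2 : ∀ h₁ h₂ u, A₂ h₁ + A₁ h₂ + B u =
      (1 / 2 : ℂ) • ((N ((h₁, h₂), u)).1.2 + (N ((h₂, h₁), u)).1.1) := by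
    intro h₁ h₂ u
    rw [add_comm (A₂ h₁), k1, add_comm ((N ((h₁, h₂), u)).1.2)]
  have k3 : ∀ h₁ h₂ u, C h₁ + C h₂ + D u =
      (1 / 2 : ℂ) • ((N ((h₁, h₂), u)).2 + (N ((h₂, h₁), u)).2) := by
    intro h₁ h₂ u
    change _ = (1 / 2 : ℂ) • (p3 (N _) + p3 (N _))
    rw [hdec, hdec]
    simp only [C, D, smul_apply, add_apply, comp_apply, map_add]
    module
  have hcon : SymColligationContractive A₁ A₂ B C D := by
    intro h₁ h₂ u
    rw [k1, k2, k3]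
    have b1 := aux_half (N ((h₁, h₂), u)).1.1 (N ((h₂, h₁), u)).1.2
    have b2 := aux_half (N ((h₁, h₂), u)).1.2 (N ((h₂, h₁), u)).1.1
    have b3 := aux_half (N ((h₁, h₂), u)).2 (N ((h₂, h₁), u)).2
    have c1 := hN1 ((h₁, h₂), u)
    have c2 := hN1 ((h₂, h₁), u)
    simp only at c1 c2
    linarith
  refine ⟨A₁, A₂, B, C, D, hcon, fun w hw => ?_⟩
  have hu : IsUnit (1 - symBlock A₁ A₂ * diagOp w.1 w.2) := by
    refine aux_isUnit A₁ A₂ (fun h₁ h₂ => ?_) w hw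
    have h := hcon h₁ h₂ 0
    simp only [map_zero, add_zero, norm_zero] at h
    nlinarith [sq_nonneg ‖C h₁ + C h₂‖]
  refine ⟨hu, ?_⟩
  ext u
  have n1 := hN2 (⟨w, hw⟩, u)
  have n2 := hN2 (⟨(w.2, w.1), aux_swap_mem hw⟩, u)
  simp only at n1 n2
  rw [aux_transfer A₁ A₂ B C D w.1 w.2 hu u (g w u) (g (w.2, w.1) u)
    (by rw [k1, n1, n2]; exact aux_hh _) (by rw [k2, n1, n2]; exact aux_hh _), k3, n1, n2, hsym w hw]
  exact aux_hh _

theorem symmetric_schur_class_iff_symmetric_realization (f : ℂ × ℂ → (U →L[ℂ] Y)) :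
    (AnalyticOnNhd ℂ f bidisk ∧ (∀ w ∈ bidisk, ‖f w‖ ≤ 1) ∧
        (∀ w ∈ bidisk, f (w.2, w.1) = f w)) ↔
      ∃ (H : Type (max u v)) (_ : NormedAddCommGroup H) (_ : InnerProductSpace ℂ H)
        (_ : CompleteSpace H) (A₁ A₂ : H →L[ℂ] H) (B : U →L[ℂ] H) (C : H →L[ℂ] Y)
        (D : U →L[ℂ] Y),
        SymColligationContractive A₁ A₂ B C D ∧
          ∀ w ∈ bidisk,
            IsUnit (1 - symBlock A₁ A₂ * diagOp w.1 w.2) ∧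
              f w = symTransfer A₁ A₂ B C D w.1 w.2 := by
  constructor
  · rintro ⟨hf, hb, hsym⟩
    obtain ⟨H, i1, i2, i3, g, hg⟩ := aux_symker f hf hb hsym
    exact ⟨H, i1, i2, i3, aux_realize f hsym g hg⟩
  · rintro ⟨H, i1, i2, i3, A₁, A₂, B, C, D, hc, hw⟩
    refine ⟨?_, ?_, ?_⟩
    · intro w hm
      refine (aux_transfer_analytic A₁ A₂ B C D w (hw w hm).1).congr ?_
      filter_upwards [aux_bidisk_isOpen.mem_nhds hm] with w' hw'
      exact (hw w' hw').2.symm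
    · intro w hm
      rw [(hw w hm).2]
      exact aux_transfer_norm A₁ A₂ B C D hc w hm (hw w hm).1
    · intro w hm
      rw [(hw w hm).2, (hw _ (aux_swap_mem hm)).2]
      exact aux_transfer_symm A₁ A₂ B C D w.1 w.2 (hw w hm).1 (hw _ (aux_swap_mem hm)).1
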